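/- arXiv:2509.04227 — 2 statements merged into one kernel-verified Lean document; each statement's English description precedes it below -/
import Mathlib

section
/- Let u be a finite binary word starting with digit 0 and v a finite binary word starting with digit 1, and write u^∞, v^∞ for the periodic sequences with periods u and v, and uv^∞, vu^∞ for the eventually periodic sequences beginning with u (respectively v). If h(Ω_{u^∞,v^∞}) > 0, then dim_H π_{q₀,q₁}(Ω_{u^∞,v^∞}) = dim_H π_{q₀,q₁}(Ω_{uv^∞,vu^∞}) for all q₀,q₁ > 1, and consequently h(Ω_{u^∞,v^∞}) = h(Ω_{uv^∞,vu^∞}). -/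
open Filter Topology

/-- The base corresponding to a digit: `q0` for digit `0` (`false`), `q1` for digit `1` (`true`). -/
noncomputable def qb (q0 q1 : ℝ) (d : Bool) : ℝ := if d then q1 else q0

/-- `piE q0 q1 i = Σ_{k=1}^∞ i_k / (q_{i_1} ⋯ q_{i_k})`, with 0-based indexing. -/
noncomputable def piE (q0 q1 : ℝ) (i : ℕ → Bool) : ℝ :=
  ∑' k : ℕ, (if i k then (1 : ℝ) else 0) / ∏ j ∈ Finset.range (k + 1), qb q0 q1 (i j)

/-- Strict lexicographic order `≺` on binary sequences. -/
def lexLt (u v : ℕ → Bool) : Prop := ∃ n : ℕ, (∀ m, m < n → u m = v m) ∧ u n < v n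

/-- Non-strict lexicographic order `⪯`. -/
def lexLe (u v : ℕ → Bool) : Prop := lexLt u v ∨ u = v

/-- The tail `i_{n+1} i_{n+2} ⋯` of a sequence (0-based: drop the first `n` entries). -/
def shiftTail (i : ℕ → Bool) (n : ℕ) : ℕ → Bool := fun k => i (n + k)

/-- `Omega a b` : sequences none of whose tails lies in the open lexicographic interval `]a,b[`. -/
def Omega (a b : ℕ → Bool) : Set (ℕ → Bool) :=
  {i | ∀ n : ℕ, ¬ (lexLt a (shiftTail i n) ∧ lexLt (shiftTail i n) b)}

/-- `(a,b) ∈ W` : `a` starts with digit 0, `b` starts with digit 1, and `a, b ∈ Ω_{a,b}`. -/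
def memW (a b : ℕ → Bool) : Prop :=
  a 0 = false ∧ b 0 = true ∧ a ∈ Omega a b ∧ b ∈ Omega a b

/-- The set `L_{a,b,n}` of length-`n` prefixes of elements of `Ω_{a,b}`, as a finset. -/
noncomputable def Lwords (a b : ℕ → Bool) (n : ℕ) : Finset (Fin n → Bool) :=
  Set.Finite.toFinset
    (Set.toFinite {w : Fin n → Bool | ∃ i ∈ Omega a b, ∀ k : Fin n, i k.1 = w k})

/-- Topological entropy `h(Ω_{a,b}) = lim_{n→∞} (1/n) log #L_{a,b,n}`; the limit exists by
subadditivity, hence it coincides with the `limsup` used here. -/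
noncomputable def entropy (a b : ℕ → Bool) : ℝ :=
  Filter.limsup (fun n : ℕ => Real.log ((Lwords a b n).card) / n) Filter.atTop

/-- The periodic sequence `u^∞` with period the finite word `u`. -/
def perSeq (u : List Bool) : ℕ → Bool := fun k => u.getD (k % u.length) false

/-- The concatenation `u x` of a finite word `u` with a sequence `x`. -/
def wordSeq (u : List Bool) (x : ℕ → Bool) : ℕ → Bool :=
  fun k => if k < u.length then u.getD k false else x (k - u.length)

/-! ### Order and shift basics -/

lemma lexLt_iff (x y : ℕ → Bool) : lexLt x y ↔ toLex x < toLex y := Iff.rfl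

/-- agreement on the first `n` letters -/
def agr (n : ℕ) (x y : ℕ → Bool) : Prop := ∀ m, m < n → x m = y m

lemma lt_iff_agr (x y : ℕ → Bool) :
    toLex x < toLex y ↔ ∃ n, agr n x y ∧ x n = false ∧ y n = true := by
  rw [← lexLt_iff]
  unfold lexLt agr
  simp only [Bool.lt_iff]

lemma agr.symm {n : ℕ} {x y : ℕ → Bool} (h : agr n x y) : agr n y x := fun m hm => (h m hm).symm

lemma agr.trans {n : ℕ} {x y z : ℕ → Bool} (h : agr n x y) (h' : agr n y z) : agr n x z :=
  fun m hm => (h m hm).trans (h' m hm)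

lemma agr.mono {n k : ℕ} {x y : ℕ → Bool} (h : agr n x y) (hk : k ≤ n) : agr k x y :=
  fun m hm => h m (lt_of_lt_of_le hm hk)

lemma exists_first_diff {x y : ℕ → Bool} (h : x ≠ y) : ∃ n, agr n x y ∧ x n ≠ y n := by
  classical
  have h' : ∃ n, x n ≠ y n := by
    by_contra hc
    push Not at hc
    exact h (funext hc)
  refine ⟨Nat.find h', ?_, Nat.find_spec h'⟩
  intro m hm
  have := Nat.find_min h' hm
  simpa using this

lemma sandwich {n : ℕ} {x y z : ℕ → Bool} (h : agr n x y) (h1 : toLex x ≤ toLex z)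
    (h2 : toLex z ≤ toLex y) : agr n x z := by
  by_cases hxz : x = z
  · subst hxz; intro m _; rfl
  obtain ⟨m, hm, hd⟩ := exists_first_diff hxz
  by_cases hmn : n ≤ m
  · exact hm.mono hmn
  push Not at hmn
  exfalso
  cases hx : x m <;> cases hz : z m <;> simp [hx, hz] at hd
  · have : toLex y < toLex z := (lt_iff_agr _ _).2
      ⟨m, (h.mono hmn.le).symm.trans hm, by rw [← h m hmn, hx], hz⟩
    order
  · have : toLex z < toLex x := (lt_iff_agr _ _).2 ⟨m, hm.symm, hz, hx⟩
    order

lemma wordSeq_lt {w : List Bool} {x : ℕ → Bool} {k : ℕ} (h : k < w.length) :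
    wordSeq w x k = w.getD k false := by simp [wordSeq, h]

lemma wordSeq_ge (w : List Bool) (x : ℕ → Bool) (k : ℕ) :
    wordSeq w x (w.length + k) = x k := by simp [wordSeq]

lemma shift_wordSeq (w : List Bool) (x : ℕ → Bool) : shiftTail (wordSeq w x) w.length = x := by
  funext k; simp [shiftTail, wordSeq]

lemma shift_shift (x : ℕ → Bool) (n m : ℕ) :
    shiftTail (shiftTail x n) m = shiftTail x (n + m) := by
  funext k; simp [shiftTail, add_assoc]

lemma shift_zero (x : ℕ → Bool) : shiftTail x 0 = x := by
  funext k; simp [shiftTail]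

lemma wordSeq_nil (x : ℕ → Bool) : wordSeq [] x = x := by
  funext k; simp [wordSeq]

lemma wordSeq_append (w w' : List Bool) (x : ℕ → Bool) :
    wordSeq (w ++ w') x = wordSeq w (wordSeq w' x) := by
  funext k
  unfold wordSeq
  by_cases h : k < w.length
  · have : k < w.length + w'.length := by omega
    simp [h, this, List.getD_append]
  · push Not at h
    by_cases h2 : k < w.length + w'.length
    · have h3 : k - w.length < w'.length := by omega
      simp [h2, h3, not_lt.2 h, List.getD_append_right _ _ _ _ h]
      exact List.getElem_append_right h
    · have h3 : ¬ k - w.length < w'.length := by omega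
      simp [h2, h3, not_lt.2 h, Nat.sub_sub]

lemma agr_wordSeq (w : List Bool) (x y : ℕ → Bool) : agr w.length (wordSeq w x) (wordSeq w y) := by
  intro m hm
  rw [wordSeq_lt hm, wordSeq_lt hm]

lemma agr_wordSeq_add {w : List Bool} {x y : ℕ → Bool} {n : ℕ} :
    agr (w.length + n) (wordSeq w x) (wordSeq w y) ↔ agr n x y := by
  constructor
  · intro h m hm
    have := h (w.length + m) (by omega)
    rwa [wordSeq_ge, wordSeq_ge] at this
  · intro h m hm
    by_cases h1 : m < w.length
    · exact agr_wordSeq w x y m h1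
    · obtain ⟨k, rfl⟩ := Nat.exists_eq_add_of_le (not_lt.1 h1)
      rw [wordSeq_ge, wordSeq_ge]; exact h k (by omega)

lemma eq_wordSeq_of_agr {w : List Bool} {x z : ℕ → Bool} (h : agr w.length z (wordSeq w x)) :
    z = wordSeq w (shiftTail z w.length) := by
  funext k
  by_cases h1 : k < w.length
  · rw [h k h1, wordSeq_lt h1, wordSeq_lt h1]
  · obtain ⟨m, rfl⟩ := Nat.exists_eq_add_of_le (not_lt.1 h1)
    rw [wordSeq_ge]; rfl

lemma wordSeq_lt_iff {w : List Bool} {x y : ℕ → Bool} :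
    toLex (wordSeq w x) < toLex (wordSeq w y) ↔ toLex x < toLex y := by
  rw [lt_iff_agr, lt_iff_agr]
  constructor
  · rintro ⟨n, h, h1, h2⟩
    by_cases hn : n < w.length
    · rw [wordSeq_lt hn] at h1 h2; exact absurd (h1.symm.trans h2) (by simp)
    · obtain ⟨k, rfl⟩ := Nat.exists_eq_add_of_le (not_lt.1 hn)
      rw [wordSeq_ge] at h1 h2
      exact ⟨k, agr_wordSeq_add.1 h, h1, h2⟩
  · rintro ⟨n, h, h1, h2⟩
    exact ⟨w.length + n, agr_wordSeq_add.2 h, by rwa [wordSeq_ge], by rwa [wordSeq_ge]⟩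

lemma wordSeq_le_iff {w : List Bool} {x y : ℕ → Bool} :
    toLex (wordSeq w x) ≤ toLex (wordSeq w y) ↔ toLex x ≤ toLex y := by
  exact not_lt.symm.trans ((not_congr wordSeq_lt_iff).trans not_lt)

lemma wordSeq_inj {w : List Bool} {x y : ℕ → Bool} (h : wordSeq w x = wordSeq w y) : x = y := by
  rw [← shift_wordSeq w x, h, shift_wordSeq]

/-- prefix of length `n` -/
def pre (x : ℕ → Bool) (n : ℕ) : List Bool := List.ofFn (fun k : Fin n => x k)

@[simp] lemma pre_length (x : ℕ → Bool) (n : ℕ) : (pre x n).length = n := by simp [pre]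

lemma wordSeq_pre (x : ℕ → Bool) (n : ℕ) : wordSeq (pre x n) (shiftTail x n) = x := by
  funext k
  by_cases h1 : k < n
  · rw [wordSeq_lt (by simpa using h1)]
    simp [pre, List.getD_eq_getElem?_getD, List.getElem?_ofFn, h1]
  · obtain ⟨m, rfl⟩ := Nat.exists_eq_add_of_le (not_lt.1 h1)
    have := wordSeq_ge (pre x n) (shiftTail x n) m
    rw [pre_length] at this
    rw [this]; rfl

lemma pre_eq_iff {x y : ℕ → Bool} {n : ℕ} : pre x n = pre y n ↔ agr n x y := by
  unfold pre agr
  rw [List.ofFn_inj]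
  constructor
  · intro h m hm; exact congrFun h ⟨m, hm⟩
  · intro h; funext k; exact h k k.2

lemma wordSeq_pre_of_agr {x y : ℕ → Bool} {n : ℕ} (h : agr n x y) :
    y = wordSeq (pre x n) (shiftTail y n) := by
  rw [pre_eq_iff.2 h, wordSeq_pre]

lemma wordSeq_getD_word (w : List Bool) (x : ℕ → Bool) : pre (wordSeq w x) w.length = w := by
  apply List.ext_getElem
  · simp
  · intro n h1 h2
    simp only [pre, List.getElem_ofFn]
    rw [wordSeq_lt h2, List.getD_eq_getElem _ _ h2]

lemma pre_add (x : ℕ → Bool) (n m : ℕ) : pre x (n + m) = pre x n ++ pre (shiftTail x n) m := by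
  unfold pre
  rw [List.ofFn_add]
  rfl

lemma pre_succ (x : ℕ → Bool) (n : ℕ) : pre x (n + 1) = x 0 :: pre (shiftTail x 1) n := by
  rw [add_comm, pre_add]; simp [pre]

/-! ### Periodic sequences -/

lemma perSeq_eq {u : List Bool} (_hu : u ≠ []) : perSeq u = wordSeq u (perSeq u) := by
  funext k
  unfold perSeq wordSeq
  split_ifs with h
  · rw [Nat.mod_eq_of_lt h]
  · rw [Nat.mod_eq_sub_mod (not_lt.1 h)]

lemma iter_eq {s : List Bool} (hs : s ≠ []) (Q : (ℕ → Bool) → Prop)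
    (hQ : ∀ z, Q z → ∃ y, z = wordSeq s y ∧ Q y) {z : ℕ → Bool} (hz : Q z) : z = perSeq s := by
  have hl : 0 < s.length := List.length_pos_iff.2 hs
  have key : ∀ n, ∀ z, Q z → z n = perSeq s n := by
    intro n
    induction n using Nat.strong_induction_on with
    | _ n ih =>
      intro z hz
      obtain ⟨y, rfl, hy⟩ := hQ z hz
      rw [perSeq_eq hs]
      by_cases h : n < s.length
      · rw [wordSeq_lt h, wordSeq_lt h]
      · obtain ⟨m, rfl⟩ := Nat.exists_eq_add_of_le (not_lt.1 h)
        rw [wordSeq_ge, wordSeq_ge]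
        exact ih m (by omega) y hy
  exact funext fun n => key n z hz

lemma eq_perSeq {s : List Bool} (hs : s ≠ []) {z : ℕ → Bool} (h : z = wordSeq s z) :
    z = perSeq s :=
  iter_eq hs (fun y => y = z) (fun y hy => ⟨z, by rw [hy]; exact h, rfl⟩) rfl

lemma shift_perSeq {u : List Bool} (hu : u ≠ []) : shiftTail (perSeq u) u.length = perSeq u := by
  conv_lhs => rw [perSeq_eq hu]
  exact shift_wordSeq _ _

lemma shift_perSeq_mul {u : List Bool} (hu : u ≠ []) (k : ℕ) :
    shiftTail (perSeq u) (u.length * k) = perSeq u := by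
  induction k with
  | zero => simp [shift_zero]
  | succ k ih => rw [Nat.mul_succ, ← shift_shift, ih, shift_perSeq hu]

lemma shift_perSeq_mod {u : List Bool} (hu : u ≠ []) (k : ℕ) :
    shiftTail (perSeq u) k = shiftTail (perSeq u) (k % u.length) := by
  conv_lhs => rw [← Nat.div_add_mod k u.length, ← shift_shift, shift_perSeq_mul hu]

lemma pre_perSeq {u : List Bool} (hu : u ≠ []) : pre (perSeq u) u.length = u := by
  rw [perSeq_eq hu]; exact wordSeq_getD_word _ _

lemma perSeq_zero {u : List Bool} {d : Bool} (hu : u.head? = some d) : perSeq u 0 = d := by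
  cases u with
  | nil => simp at hu
  | cons a l => simp at hu; subst hu; simp [perSeq]

lemma ne_nil_of_head {u : List Bool} {d : Bool} (hu : u.head? = some d) : u ≠ [] := by
  rintro rfl; simp at hu

lemma pre_perSeq_initial {u : List Bool} (hu : u ≠ []) {k : ℕ} (hk : k ≤ u.length) :
    List.Subperm (pre (perSeq u) k) u := by
  have : pre (perSeq u) u.length = u := pre_perSeq hu
  obtain ⟨m, hm⟩ := Nat.exists_eq_add_of_le hk
  rw [hm, pre_add] at this
  conv_rhs => rw [← this]
  exact (List.sublist_append_left _ _).subperm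

/-- a rotation of a periodic sequence is periodic with a permuted word -/
lemma shift_perSeq_perm {u : List Bool} (hu : u ≠ []) (k : ℕ) :
    (pre (shiftTail (perSeq u) k) u.length).Perm u := by
  induction k with
  | zero => rw [shift_zero, pre_perSeq hu]
  | succ k ih =>
    refine List.Perm.trans ?_ ih
    have hl : 0 < u.length := List.length_pos_iff.2 hu
    set y := shiftTail (perSeq u) k with hy
    have hy1 : shiftTail (perSeq u) (k + 1) = shiftTail y 1 := by rw [hy, shift_shift]
    rw [hy1]
    have e1 := pre_succ y u.length
    have e2 := pre_add y u.length 1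
    have e3 : pre (shiftTail y u.length) 1 = [y 0] := by
      have : shiftTail y u.length = y := by
        rw [hy, shift_shift, add_comm, ← shift_shift, shift_perSeq hu]
      rw [this]; simp [pre]
    rw [e3] at e2
    rw [e2] at e1
    have : (y 0 :: pre (shiftTail y 1) u.length).Perm (y 0 :: pre y u.length) := by
      rw [← e1]; exact List.perm_append_singleton _ _
    exact (List.perm_cons _).1 this

lemma shift_perSeq_eq_perSeq {u : List Bool} (hu : u ≠ []) (k : ℕ) :
    shiftTail (perSeq u) k = perSeq (pre (shiftTail (perSeq u) k) u.length) := by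
  have hl : 0 < u.length := List.length_pos_iff.2 hu
  apply eq_perSeq
  · intro h
    have := congrArg List.length h
    rw [pre_length] at this; simp only [List.length_nil] at this; omega
  · conv_lhs => rw [← wordSeq_pre (shiftTail (perSeq u) k) u.length]
    congr 1
    rw [shift_shift, add_comm, ← shift_shift, shift_perSeq hu]

lemma lt_of_zero {x y : ℕ → Bool} (hx : x 0 = false) (hy : y 0 = true) : toLex x < toLex y :=
  (lt_iff_agr _ _).2 ⟨0, fun m hm => absurd hm (Nat.not_lt_zero _), hx, hy⟩

lemma mem_Omega {a b x : ℕ → Bool} : x ∈ Omega a b ↔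
    ∀ n, ¬ (toLex a < toLex (shiftTail x n) ∧ toLex (shiftTail x n) < toLex b) := Iff.rfl

lemma Omega_shift {a b x : ℕ → Bool} (h : x ∈ Omega a b) (n : ℕ) : shiftTail x n ∈ Omega a b := by
  rw [mem_Omega] at h ⊢
  intro m; rw [shift_shift]; exact h _

lemma Omega_or {a b x : ℕ → Bool} (h : x ∈ Omega a b) :
    toLex x ≤ toLex a ∨ toLex b ≤ toLex x := by
  have := mem_Omega.1 h 0
  rw [shift_zero] at this
  by_contra hc
  push Not at hc
  exact this hc

lemma Omega_mono {a b a' b' : ℕ → Bool} (h1 : toLex a ≤ toLex a') (h2 : toLex b' ≤ toLex b) :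
    Omega a b ⊆ Omega a' b' := by
  intro x hx n h
  rw [lexLt_iff, lexLt_iff] at h
  exact mem_Omega.1 hx n ⟨by order [h.1], by order [h.2]⟩


/-! ### Substitutions -/

/-- block of a digit -/
def blk (u v : List Bool) (d : Bool) : List Bool := if d then v else u

/-- concatenation of the first `k` blocks along the code `j` -/
def wd (u v : List Bool) : (ℕ → Bool) → ℕ → List Bool
  | _, 0 => []
  | j, k + 1 => blk u v (j 0) ++ wd u v (shiftTail j 1) k

/-- the infinite concatenation of blocks along `j` -/
def sig (u v : List Bool) (j : ℕ → Bool) : ℕ → Bool := fun n => (wd u v j (n + 1)).getD n false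

lemma blk_ne {u v : List Bool} (hu : u ≠ []) (hv : v ≠ []) (d : Bool) : blk u v d ≠ [] := by
  cases d <;> simpa [blk]

lemma wd_succ (u v : List Bool) (j : ℕ → Bool) (k : ℕ) :
    wd u v j (k + 1) = blk u v (j 0) ++ wd u v (shiftTail j 1) k := rfl

lemma wd_add (u v : List Bool) (k l : ℕ) : ∀ j : ℕ → Bool,
    wd u v j (k + l) = wd u v j k ++ wd u v (shiftTail j k) l := by
  induction k with
  | zero => intro j; simp [wd, shift_zero]
  | succ k ih =>
    intro j
    rw [show k + 1 + l = (k + l) + 1 by omega, wd_succ, ih, wd_succ, shift_shift, List.append_assoc,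
      add_comm 1 k]

lemma wd_len {u v : List Bool} (hu : u ≠ []) (hv : v ≠ []) (k : ℕ) : ∀ j : ℕ → Bool,
    k ≤ (wd u v j k).length := by
  induction k with
  | zero => intro j; simp
  | succ k ih =>
    intro j
    have := ih (shiftTail j 1)
    have h2 : 0 < (blk u v (j 0)).length := List.length_pos_iff.2 (blk_ne hu hv _)
    rw [wd_succ, List.length_append]; omega

lemma wd_congr (u v : List Bool) (k : ℕ) : ∀ j j' : ℕ → Bool, agr k j j' →
    wd u v j k = wd u v j' k := by
  induction k with
  | zero => intro j j' _; rfl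
  | succ k ih =>
    intro j j' h
    rw [wd_succ, wd_succ, h 0 (by omega), ih (shiftTail j 1) (shiftTail j' 1)]
    intro m hm
    exact h (1 + m) (by omega)

lemma sig_eq1 {u v : List Bool} (hu : u ≠ []) (hv : v ≠ []) (j : ℕ → Bool) :
    sig u v j = wordSeq (blk u v (j 0)) (sig u v (shiftTail j 1)) := by
  funext n
  have h2 : 0 < (blk u v (j 0)).length := List.length_pos_iff.2 (blk_ne hu hv _)
  by_cases h : n < (blk u v (j 0)).length
  · rw [wordSeq_lt h]
    unfold sig
    rw [wd_succ, List.getD_append _ _ _ _ h]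
  · obtain ⟨m, rfl⟩ := Nat.exists_eq_add_of_le (not_lt.1 h)
    rw [wordSeq_ge]
    unfold sig
    rw [wd_succ, List.getD_append_right _ _ _ _ (by omega), Nat.add_sub_cancel_left]
    obtain ⟨l, hl⟩ := Nat.exists_eq_add_of_le (show m + 1 ≤ (blk u v (j 0)).length + m by omega)
    rw [hl, wd_add, List.getD_append]
    have := wd_len hu hv (m + 1) (shiftTail j 1)
    omega

lemma sig_eq {u v : List Bool} (hu : u ≠ []) (hv : v ≠ []) (k : ℕ) : ∀ j : ℕ → Bool,
    sig u v j = wordSeq (wd u v j k) (sig u v (shiftTail j k)) := by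
  induction k with
  | zero => intro j; simp [wd, shift_zero, wordSeq_nil]
  | succ k ih =>
    intro j
    rw [wd_succ, wordSeq_append, sig_eq1 hu hv j, ih (shiftTail j 1), shift_shift, add_comm 1 k]

lemma sig_coind {u v : List Bool} (hu : u ≠ []) (hv : v ≠ []) (Q : (ℕ → Bool) → Prop)
    (hQ : ∀ z, Q z → ∃ d y, z = wordSeq (blk u v d) y ∧ Q y) {z : ℕ → Bool} (hz : Q z) :
    z ∈ Set.range (sig u v) := by
  choose! d y h1 h2 using hQ
  have hQn : ∀ n, Q (y^[n] z) := by
    intro n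
    induction n with
    | zero => exact hz
    | succ n ih => rw [Function.iterate_succ_apply']; exact h2 _ ih
  have key : ∀ n, ∀ m, (y^[m] z) n = sig u v (fun k => d (y^[m + k] z)) n := by
    intro n
    induction n using Nat.strong_induction_on with
    | _ n ih =>
      intro m
      rw [h1 _ (hQn m), sig_eq1 hu hv]
      simp only [add_zero]
      have hl : 0 < (blk u v (d (y^[m] z))).length := List.length_pos_iff.2 (blk_ne hu hv _)
      by_cases h : n < (blk u v (d (y^[m] z))).length
      · rw [wordSeq_lt h, wordSeq_lt h]
      · obtain ⟨i, hi⟩ := Nat.exists_eq_add_of_le (not_lt.1 h)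
        rw [hi, wordSeq_ge, wordSeq_ge, ← Function.iterate_succ_apply' y m z, ih i (by omega)]
        congr 1
        funext k
        simp only [shiftTail]
        rw [show m.succ + k = m + (1 + k) by omega]
  refine ⟨fun k => d (y^[0 + k] z), ?_⟩
  funext n
  exact (key n 0).symm

lemma wd_length_mono {u v α β : List Bool} (h1 : α.length ≤ u.length) (h2 : β.length ≤ v.length)
    (k : ℕ) : ∀ j : ℕ → Bool, (wd α β j k).length ≤ (wd u v j k).length := by
  induction k with
  | zero => intro j; simp [wd]
  | succ k ih =>
    intro j
    have := ih (shiftTail j 1)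
    rw [wd_succ, wd_succ, List.length_append, List.length_append]
    have : (blk α β (j 0)).length ≤ (blk u v (j 0)).length := by
      cases j 0 <;> simpa [blk]
    omega

lemma sig_shift_range {u v : List Bool} (j : ℕ → Bool) (k : ℕ) :
    sig u v (shiftTail j k) ∈ Set.range (sig u v) := ⟨_, rfl⟩

/-! ### Structure of the larger shift -/

lemma a_lt {u v : List Bool} (hu : u.head? = some false) (hv : v.head? = some true) :
    toLex (perSeq u) < toLex (wordSeq u (perSeq v)) := by
  conv_lhs => rw [perSeq_eq (ne_nil_of_head hu)]
  exact wordSeq_lt_iff.2 (lt_of_zero (perSeq_zero hu) (perSeq_zero hv))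

lemma b_lt {u v : List Bool} (hu : u.head? = some false) (hv : v.head? = some true) :
    toLex (wordSeq v (perSeq u)) < toLex (perSeq v) := by
  conv_rhs => rw [perSeq_eq (ne_nil_of_head hv)]
  exact wordSeq_lt_iff.2 (lt_of_zero (perSeq_zero hu) (perSeq_zero hv))

lemma Omega_sub {u v : List Bool} (hu : u.head? = some false) (hv : v.head? = some true) :
    Omega (perSeq u) (perSeq v) ⊆ Omega (wordSeq u (perSeq v)) (wordSeq v (perSeq u)) :=
  Omega_mono (a_lt hu hv).le (b_lt hu hv).le

/-- if `z` lies between `s x` and `s y` then `z` starts with `s` -/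
lemma between_word {s : List Bool} {x y z : ℕ → Bool} (h1 : toLex (wordSeq s x) ≤ toLex z)
    (h2 : toLex z ≤ toLex (wordSeq s y)) : ∃ z', z = wordSeq s z' ∧ z' = shiftTail z s.length ∧
      toLex x ≤ toLex z' ∧ toLex z' ≤ toLex y := by
  have h := eq_wordSeq_of_agr (sandwich (agr_wordSeq s x y) h1 h2).symm
  refine ⟨_, h, rfl, ?_, ?_⟩
  · rw [h] at h1; exact wordSeq_le_iff.1 h1
  · rw [h] at h2; exact wordSeq_le_iff.1 h2

lemma structure_cat {u v : List Bool} (hu : u.head? = some false) (hv : v.head? = some true)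
    {z : ℕ → Bool} (hz : z ∈ Omega (wordSeq u (perSeq v)) (wordSeq v (perSeq u)))
    (h1 : toLex (perSeq u) ≤ toLex z) (h2 : toLex z ≤ toLex (perSeq v)) :
    z ∈ Set.range (sig u v) := by
  have hu' := ne_nil_of_head hu
  have hv' := ne_nil_of_head hv
  refine sig_coind hu' hv' (fun z => z ∈ Omega (wordSeq u (perSeq v)) (wordSeq v (perSeq u)) ∧
    toLex (perSeq u) ≤ toLex z ∧ toLex z ≤ toLex (perSeq v)) ?_ ⟨hz, h1, h2⟩
  rintro z ⟨hz, h1, h2⟩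
  rcases Omega_or hz with h | h
  · rw [perSeq_eq hu'] at h1
    obtain ⟨y, hy, hy', h3, h4⟩ := between_word h1 h
    exact ⟨false, y, by simpa [blk] using hy, hy' ▸ Omega_shift hz _, h3, h4⟩
  · rw [perSeq_eq hv'] at h2
    obtain ⟨y, hy, hy', h3, h4⟩ := between_word h h2
    exact ⟨true, y, by simpa [blk] using hy, hy' ▸ Omega_shift hz _, h3, h4⟩

/-! ### Reductions -/

lemma lt_perSeq_of {s : List Bool} (hs : s ≠ []) {x : ℕ → Bool}
    (h : toLex (wordSeq s x) < toLex x) : toLex (perSeq s) < toLex x := by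
  by_contra hc
  replace hc := not_lt.1 hc
  rcases hc.lt_or_eq with hc | hc
  · have : x = perSeq s := by
      refine iter_eq hs (fun z => z = x ∨ (toLex (wordSeq s x) ≤ toLex z ∧
        toLex z ≤ toLex (perSeq s))) ?_ (Or.inl rfl)
      intro z hz
      have hz' : toLex (wordSeq s x) ≤ toLex z ∧ toLex z ≤ toLex (perSeq s) := by
        rcases hz with rfl | h'
        · exact ⟨h.le, hc.le⟩
        · exact h'
      rw [perSeq_eq hs] at hz'
      obtain ⟨y, hy, _, h3, h4⟩ := between_word hz'.1 hz'.2
      exact ⟨y, hy, Or.inr ⟨by order, h4⟩⟩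
    rw [this] at hc
    exact lt_irrefl _ hc
  · have hx : x = perSeq s := toLex.injective hc
    rw [hx, ← perSeq_eq hs] at h
    exact lt_irrefl _ h

lemma gt_perSeq_of {s : List Bool} (hs : s ≠ []) {x : ℕ → Bool}
    (h : toLex x < toLex (wordSeq s x)) : toLex x < toLex (perSeq s) := by
  by_contra hc
  replace hc := not_lt.1 hc
  rcases hc.lt_or_eq with hc | hc
  · have : x = perSeq s := by
      refine iter_eq hs (fun z => toLex (perSeq s) ≤ toLex z ∧
        toLex z ≤ toLex (wordSeq s x)) ?_ ⟨hc.le, h.le⟩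
      intro z hz'
      rw [perSeq_eq hs] at hz'
      obtain ⟨y, hy, _, h3, h4⟩ := between_word hz'.1 hz'.2
      exact ⟨y, hy, h3, by order⟩
    rw [this] at hc
    exact lt_irrefl _ hc
  · have hx : x = perSeq s := (toLex.injective hc).symm
    rw [hx, ← perSeq_eq hs] at h
    exact lt_irrefl _ h

/-- non-admissible left endpoint -/
lemma red_left {a b : ℕ → Bool} {k : ℕ} (hk : 0 < k) (h1 : toLex a < toLex (shiftTail a k))
    (h2 : toLex (shiftTail a k) < toLex b) :
    toLex (perSeq (pre a k)) < toLex a ∧ Omega a b = Omega (perSeq (pre a k)) b := by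
  have hs : pre a k ≠ [] := List.length_pos_iff.1 (by simpa using hk)
  have h3 : toLex (perSeq (pre a k)) < toLex a := by
    apply lt_perSeq_of hs
    conv_rhs => rw [← wordSeq_pre a k]
    exact wordSeq_lt_iff.2 h1
  refine ⟨h3, Set.Subset.antisymm ?_ (Omega_mono h3.le le_rfl)⟩
  intro x hx
  rw [mem_Omega]
  rintro n ⟨h4, h5⟩
  have : shiftTail x n = perSeq (pre a k) := by
    refine iter_eq hs (fun z => z ∈ Omega a b ∧ toLex (perSeq (pre a k)) ≤ toLex z ∧
      toLex z < toLex b) ?_ ⟨Omega_shift hx n, h4.le, h5⟩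
    rintro z ⟨hz, h6, h7⟩
    have h8 : toLex z ≤ toLex a := (Omega_or hz).resolve_right (not_le.2 h7)
    rw [perSeq_eq hs] at h6
    rw [← wordSeq_pre a k] at h8
    obtain ⟨y, hy, hy', h9, h10⟩ := between_word h6 h8
    exact ⟨y, hy, hy' ▸ Omega_shift hz _, h9, by order⟩
  rw [this] at h4
  exact lt_irrefl _ h4

/-- non-admissible right endpoint -/
lemma red_right {a b : ℕ → Bool} {k : ℕ} (hk : 0 < k) (h1 : toLex a < toLex (shiftTail b k))
    (h2 : toLex (shiftTail b k) < toLex b) :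
    toLex b < toLex (perSeq (pre b k)) ∧ Omega a b = Omega a (perSeq (pre b k)) := by
  have hs : pre b k ≠ [] := List.length_pos_iff.1 (by simpa using hk)
  have h3 : toLex b < toLex (perSeq (pre b k)) := by
    apply gt_perSeq_of hs
    conv_lhs => rw [← wordSeq_pre b k]
    exact wordSeq_lt_iff.2 h2
  refine ⟨h3, Set.Subset.antisymm ?_ (Omega_mono le_rfl h3.le)⟩
  intro x hx
  rw [mem_Omega]
  rintro n ⟨h4, h5⟩
  have : shiftTail x n = perSeq (pre b k) := by
    refine iter_eq hs (fun z => z ∈ Omega a b ∧ toLex a < toLex z ∧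
      toLex z ≤ toLex (perSeq (pre b k))) ?_ ⟨Omega_shift hx n, h4, h5.le⟩
    rintro z ⟨hz, h6, h7⟩
    have h8 : toLex b ≤ toLex z := (Omega_or hz).resolve_left (not_le.2 h6)
    rw [perSeq_eq hs] at h7
    rw [← wordSeq_pre b k] at h8
    obtain ⟨y, hy, hy', h9, h10⟩ := between_word h8 h7
    exact ⟨y, hy, hy' ▸ Omega_shift hz _, by order, h10⟩
  rw [this] at h5
  exact lt_irrefl _ h5

/-! ### Counting -/

/-- prefixes of length `n` -/
def Pr (S : Set (ℕ → Bool)) (n : ℕ) : Set (List Bool) := (fun x => pre x n) '' S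

noncomputable def pc (S : Set (ℕ → Bool)) (n : ℕ) : ℕ := (Pr S n).ncard

lemma Pr_finite (S : Set (ℕ → Bool)) (n : ℕ) : (Pr S n).Finite :=
  (List.finite_length_eq Bool n).subset (by rintro _ ⟨x, _, rfl⟩; simp)

lemma pc_mono {S S' : Set (ℕ → Bool)} (h : S ⊆ S') (n : ℕ) : pc S n ≤ pc S' n :=
  Set.ncard_le_ncard (Set.image_mono h) (Pr_finite S' n)

lemma Pr_eq (S : Set (ℕ → Bool)) (n : ℕ) :
    Pr S n = List.ofFn '' {w : Fin n → Bool | ∃ i ∈ S, ∀ k : Fin n, i k.1 = w k} := by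
  ext l
  constructor
  · rintro ⟨x, hx, rfl⟩
    exact ⟨fun k => x k, ⟨x, hx, fun _ => rfl⟩, rfl⟩
  · rintro ⟨w, ⟨x, hx, h⟩, rfl⟩
    refine ⟨x, hx, ?_⟩
    simp only [pre]
    congr 1
    funext k; exact h k

lemma pc_eq (S : Set (ℕ → Bool)) (n : ℕ) :
    pc S n = {w : Fin n → Bool | ∃ i ∈ S, ∀ k : Fin n, i k.1 = w k}.ncard := by
  rw [pc, Pr_eq, Set.ncard_image_of_injective _ List.ofFn_injective]

lemma Lwords_card (a b : ℕ → Bool) (n : ℕ) : (Lwords a b n).card = pc (Omega a b) n := by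
  rw [pc_eq, Lwords, Set.ncard_eq_toFinset_card]

lemma pc_le_pow (S : Set (ℕ → Bool)) (n : ℕ) : pc S n ≤ 2 ^ n := by
  rw [pc_eq]
  refine (Set.ncard_le_card _).trans ?_
  simp

lemma pc_split {S Y Z : Set (ℕ → Bool)} {k m : ℕ}
    (h : ∀ x ∈ S, pre x k ∈ Pr Y k ∧ pre (shiftTail x k) m ∈ Pr Z m) :
    pc S (k + m) ≤ pc Y k * pc Z m := by
  have : Pr S (k + m) ⊆ (fun p : List Bool × List Bool => p.1 ++ p.2) '' (Pr Y k ×ˢ Pr Z m) := by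
    rintro _ ⟨x, hx, rfl⟩
    exact ⟨(pre x k, pre (shiftTail x k) m), h x hx, (pre_add x k m).symm⟩
  have hf : (Pr Y k ×ˢ Pr Z m).Finite := (Pr_finite _ _).prod (Pr_finite _ _)
  calc pc S (k + m) ≤ _ := Set.ncard_le_ncard this (hf.image _)
    _ ≤ (Pr Y k ×ˢ Pr Z m).ncard := Set.ncard_image_le hf
    _ = _ := Set.ncard_prod

lemma zeros_le (x : ℕ → Bool) : toLex (fun _ : ℕ => false) ≤ toLex x := by
  by_contra h
  obtain ⟨n, _, _, h2⟩ := (lt_iff_agr _ _).1 (not_le.1 h)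
  simp at h2

lemma le_ones (x : ℕ → Bool) : toLex x ≤ toLex (fun _ : ℕ => true) := by
  by_contra h
  obtain ⟨n, _, h2, _⟩ := (lt_iff_agr _ _).1 (not_le.1 h)
  simp at h2

lemma zeros_mem (a b : ℕ → Bool) : (fun _ => false) ∈ Omega a b := by
  rw [mem_Omega]
  rintro n ⟨h, _⟩
  exact not_lt.2 (zeros_le a) h

lemma ones_mem (a b : ℕ → Bool) : (fun _ => true) ∈ Omega a b := by
  rw [mem_Omega]
  rintro n ⟨_, h⟩
  exact not_lt.2 (le_ones b) h

lemma pc_pos (a b : ℕ → Bool) (n : ℕ) : 0 < pc (Omega a b) n := by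
  rw [pc, Set.ncard_pos (Pr_finite _ _)]
  exact ⟨_, _, zeros_mem a b, rfl⟩

lemma entropy_eq (a b : ℕ → Bool) :
    entropy a b = Filter.limsup (fun n : ℕ => Real.log (pc (Omega a b) n) / n) atTop := by
  unfold entropy
  simp only [Lwords_card]

lemma ent_nonneg (a b : ℕ → Bool) (n : ℕ) : 0 ≤ Real.log (pc (Omega a b) n) / n :=
  div_nonneg (Real.log_natCast_nonneg _) (Nat.cast_nonneg _)

lemma ent_le (a b : ℕ → Bool) (n : ℕ) : Real.log (pc (Omega a b) n) / n ≤ Real.log 2 := by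
  rcases Nat.eq_zero_or_pos n with rfl | hn
  · simp; positivity
  rw [div_le_iff₀ (by exact_mod_cast hn), mul_comm, ← Real.log_pow]
  apply Real.log_le_log (by exact_mod_cast pc_pos a b n)
  exact_mod_cast pc_le_pow _ n

lemma ent_bdd (a b : ℕ → Bool) :
    IsBoundedUnder (· ≤ ·) atTop (fun n : ℕ => Real.log (pc (Omega a b) n) / n) :=
  isBoundedUnder_of ⟨_, ent_le a b⟩

lemma ent_cobdd (a b : ℕ → Bool) :
    IsCoboundedUnder (· ≤ ·) atTop (fun n : ℕ => Real.log (pc (Omega a b) n) / n) :=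
  IsBoundedUnder.isCoboundedUnder_le (isBoundedUnder_of ⟨_, ent_nonneg a b⟩)

lemma entropy_mono {a b a' b' : ℕ → Bool} (h : Omega a b ⊆ Omega a' b') :
    entropy a b ≤ entropy a' b' := by
  rw [entropy_eq, entropy_eq]
  refine limsup_le_limsup (Eventually.of_forall fun n => ?_) (ent_cobdd a b) (ent_bdd a' b')
  refine div_le_div_of_nonneg_right ?_ (Nat.cast_nonneg _)
  apply Real.log_le_log (by exact_mod_cast pc_pos a b n)
  exact_mod_cast pc_mono h n

lemma ent_E0 {a b : ℕ → Bool} {H : ℝ} (h : entropy a b < H) :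
    ∃ N : ℕ, 1 ≤ N ∧ ∀ n ≥ N, (pc (Omega a b) n : ℝ) ≤ Real.exp (H * n) := by
  rw [entropy_eq] at h
  obtain ⟨N, hN⟩ := eventually_atTop.1 (eventually_lt_of_limsup_lt h (ent_bdd a b))
  refine ⟨N + 1, by omega, fun n hn => ?_⟩
  have h1 := (hN n (by omega)).le
  have hn0 : (0 : ℝ) < n := by exact_mod_cast (by omega : 0 < n)
  rw [div_le_iff₀ hn0] at h1
  rwa [← Real.log_le_iff_le_exp (by exact_mod_cast pc_pos a b n)]

lemma ent_E1 {a b : ℕ → Bool} {H : ℝ} (hH : 0 < H) (h : entropy a b < H) :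
    ∃ C : ℝ, 0 < C ∧ ∀ n, (pc (Omega a b) n : ℝ) ≤ C * Real.exp (H * n) := by
  obtain ⟨N, _, hN⟩ := ent_E0 h
  refine ⟨2 ^ N, by positivity, fun n => ?_⟩
  have h1 : (1 : ℝ) ≤ 2 ^ N := one_le_pow₀ (by norm_num)
  by_cases hn : N ≤ n
  · have := hN n hn
    have h3 := Real.exp_pos (H * n)
    nlinarith
  · have h2 : (pc (Omega a b) n : ℝ) ≤ 2 ^ N := by
      have := (pc_le_pow (Omega a b) n).trans (Nat.pow_le_pow_right (by norm_num) (by omega : n ≤ N))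
      exact_mod_cast this
    have h3 : 1 ≤ Real.exp (H * n) := Real.one_le_exp (by positivity)
    nlinarith

lemma ent_E2 {a b : ℕ → Bool} {H C : ℝ} (hH : 0 < H)
    (h : ∀ n : ℕ, (pc (Omega a b) n : ℝ) ≤ C * (n + 1) * Real.exp (H * n)) : entropy a b ≤ H := by
  have hC : 0 < C := by
    have := h 0
    have h1 : (1 : ℝ) ≤ pc (Omega a b) 0 := by exact_mod_cast pc_pos a b 0
    simp at this; linarith
  refine le_of_forall_pos_le_add fun ε hε => ?_
  rw [entropy_eq]
  refine limsup_le_of_le (ent_cobdd a b) ?_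
  obtain ⟨N, hN⟩ := exists_nat_ge (4 * C / ε ^ 2)
  refine eventually_atTop.2 ⟨N + 1, fun n hn => ?_⟩
  have hn0 : (1 : ℝ) ≤ n := by exact_mod_cast (by omega : 1 ≤ n)
  rw [div_le_iff₀ (by linarith)]
  rw [Real.log_le_iff_le_exp (by exact_mod_cast pc_pos a b n)]
  refine (h n).trans ?_
  rw [add_mul, Real.exp_add, mul_comm]
  refine mul_le_mul_of_nonneg_left ?_ (Real.exp_pos _).le
  have h1 := Real.quadratic_le_exp_of_nonneg (x := ε * n) (by positivity)
  have h2 : 4 * C ≤ n * ε ^ 2 := by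
    rw [div_le_iff₀ (by positivity)] at hN
    have : (N : ℝ) ≤ n := by exact_mod_cast (by omega : N ≤ n)
    nlinarith [sq_nonneg ε]
  have h3 : 0 < ε * n := by positivity
  nlinarith

/-! ### Topology and compactness -/

lemma cont_ev (n : ℕ) : Continuous (fun x : ℕ → Bool => x n) := continuous_apply n

lemma isOpen_agr (n : ℕ) (a : ℕ → Bool) : IsOpen {x : ℕ → Bool | agr n a x} := by
  have : {x : ℕ → Bool | agr n a x} = ⋂ m ∈ Finset.range n, {x : ℕ → Bool | a m = x m} := by
    ext x; simp [agr]
  rw [this]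
  refine isOpen_biInter_finset fun m _ => ?_
  exact (isOpen_discrete {d : Bool | a m = d}).preimage (cont_ev m)

lemma isOpen_lexgt (a : ℕ → Bool) : IsOpen {x : ℕ → Bool | toLex a < toLex x} := by
  have : {x : ℕ → Bool | toLex a < toLex x} =
      ⋃ n, {x : ℕ → Bool | agr n a x} ∩ {x | a n = false ∧ x n = true} := by
    ext x; rw [Set.mem_ofPred_eq, lt_iff_agr]; simp
  rw [this]
  refine isOpen_iUnion fun n => (isOpen_agr n a).inter ?_
  exact (isOpen_discrete {d : Bool | a n = false ∧ d = true}).preimage (cont_ev n)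

lemma isOpen_lexlt (b : ℕ → Bool) : IsOpen {x : ℕ → Bool | toLex x < toLex b} := by
  have : {x : ℕ → Bool | toLex x < toLex b} =
      ⋃ n, {x : ℕ → Bool | agr n b x} ∩ {x | x n = false ∧ b n = true} := by
    ext x; rw [Set.mem_ofPred_eq, lt_iff_agr]
    simp only [Set.mem_iUnion, Set.mem_inter_iff, Set.mem_ofPred_eq]
    exact exists_congr fun n => and_congr_left fun _ => ⟨agr.symm, agr.symm⟩
  rw [this]
  refine isOpen_iUnion fun n => (isOpen_agr n b).inter ?_
  exact (isOpen_discrete {d : Bool | d = false ∧ b n = true}).preimage (cont_ev n)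

lemma continuous_shift (n : ℕ) : Continuous (fun x : ℕ → Bool => shiftTail x n) :=
  continuous_pi fun k => continuous_apply (n + k)

/-- sequences whose first `N` tails avoid the interval -/
def FN (a b : ℕ → Bool) (N : ℕ) : Set (ℕ → Bool) :=
  {x | ∀ i < N, ¬ (toLex a < toLex (shiftTail x i) ∧ toLex (shiftTail x i) < toLex b)}

lemma isClosed_one (a b : ℕ → Bool) (i : ℕ) : IsClosed {x : ℕ → Bool |
    ¬ (toLex a < toLex (shiftTail x i) ∧ toLex (shiftTail x i) < toLex b)} := by
  have h := ((isOpen_lexgt a).inter (isOpen_lexlt b)).preimage (continuous_shift i)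
  exact h.isClosed_compl

lemma isClosed_FN (a b : ℕ → Bool) (N : ℕ) : IsClosed (FN a b N) := by
  have : FN a b N = ⋂ i, ⋂ (_ : i < N), {x : ℕ → Bool |
    ¬ (toLex a < toLex (shiftTail x i) ∧ toLex (shiftTail x i) < toLex b)} := by
    ext x; simp only [FN, Set.mem_ofPred_eq, Set.mem_iInter]
  rw [this]
  exact isClosed_iInter fun i => isClosed_iInter fun _ => isClosed_one a b i

lemma isClosed_Omega (a b : ℕ → Bool) : IsClosed (Omega a b) := by
  have : Omega a b = ⋂ i, {x : ℕ → Bool |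
    ¬ (toLex a < toLex (shiftTail x i) ∧ toLex (shiftTail x i) < toLex b)} := by
    ext x; rw [mem_Omega, Set.mem_iInter]; rfl
  rw [this]
  exact isClosed_iInter fun i => isClosed_one a b i

lemma FN_anti {a b : ℕ → Bool} {N M : ℕ} (h : N ≤ M) : FN a b M ⊆ FN a b N :=
  fun _ hx i hi => hx i (by omega)

lemma FN_shift {a b : ℕ → Bool} {k m : ℕ} {x : ℕ → Bool} (h : x ∈ FN a b (m + k)) :
    shiftTail x m ∈ FN a b k := by
  intro i hi
  rw [shift_shift]
  exact h (m + i) (by omega)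

lemma FN_compact (a b : ℕ → Bool) (m : ℕ) :
    ∃ N, ∀ x ∈ FN a b N, pre x m ∈ Pr (Omega a b) m := by
  by_contra hc
  push Not at hc
  have hK : IsClosed {x : ℕ → Bool | pre x m ∉ Pr (Omega a b) m} := by
    have hcont : Continuous (fun (x : ℕ → Bool) (k : Fin m) => x k) :=
      continuous_pi fun k => continuous_apply _
    exact (isClosed_discrete {w : Fin m → Bool | List.ofFn w ∉ Pr (Omega a b) m}).preimage hcont
  have := IsCompact.nonempty_iInter_of_sequence_nonempty_isCompact_isClosed
    (fun N => FN a b N ∩ {x : ℕ → Bool | pre x m ∉ Pr (Omega a b) m})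
    (fun i => Set.inter_subset_inter_left _ (FN_anti (Nat.le_succ i)))
    (fun i => by obtain ⟨x, h1, h2⟩ := hc i; exact ⟨x, h1, h2⟩)
    ((isClosed_FN a b 0).inter hK).isCompact
    (fun i => (isClosed_FN a b i).inter hK)
  obtain ⟨x, hx⟩ := this
  rw [Set.mem_iInter] at hx
  refine (hx 0).2 ⟨x, ?_, rfl⟩
  rw [mem_Omega]
  exact fun n => (hx (n + 1)).1 n (by omega)

lemma FN_count {a b : ℕ → Bool} {H : ℝ} (hH : 0 < H) (h : entropy a b < H) :
    ∃ C : ℝ, 0 < C ∧ ∀ k, (pc (FN a b k) k : ℝ) ≤ C * Real.exp (H * k) := by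
  obtain ⟨m, hm, hmb⟩ := ent_E0 h
  replace hmb := hmb m le_rfl
  obtain ⟨N, hN⟩ := FN_compact a b m
  refine ⟨2 ^ (N + m), by positivity, fun k => ?_⟩
  induction k using Nat.strong_induction_on with
  | _ k ih =>
    by_cases hk : k < N + m
    · have h2 : (pc (FN a b k) k : ℝ) ≤ 2 ^ (N + m) := by
        have := (pc_le_pow (FN a b k) k).trans
          (Nat.pow_le_pow_right (by norm_num) (by omega : k ≤ N + m))
        exact_mod_cast this
      have h3 : 1 ≤ Real.exp (H * k) := Real.one_le_exp (by positivity)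
      have h1 : (1 : ℝ) ≤ 2 ^ (N + m) := one_le_pow₀ (by norm_num)
      nlinarith
    · obtain ⟨l, rfl⟩ : ∃ l, k = m + l := ⟨k - m, by omega⟩
      have h1 : pc (FN a b (m + l)) (m + l) ≤ pc (Omega a b) m * pc (FN a b l) l := by
        refine pc_split fun x hx => ⟨hN x (FN_anti (by omega) hx), ?_⟩
        exact ⟨_, FN_shift hx, rfl⟩
      have h2 : (pc (FN a b (m + l)) (m + l) : ℝ) ≤ pc (Omega a b) m * pc (FN a b l) l := by
        exact_mod_cast h1
      have h3 := ih l (by omega)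
      calc _ ≤ _ := h2
        _ ≤ Real.exp (H * m) * (2 ^ (N + m) * Real.exp (H * l)) := by gcongr
        _ = _ := by push_cast; rw [mul_add, Real.exp_add]; ring

lemma counting {a b : ℕ → Bool} {H C : ℝ} (hH : 0 < H) (h : entropy a b < H)
    {X Z : Set (ℕ → Bool)} (hXZ : ∀ x ∈ X, ∀ n, toLex a < toLex (shiftTail x n) →
      toLex (shiftTail x n) < toLex b → shiftTail x n ∈ Z)
    (hZ : ∀ n : ℕ, (pc Z n : ℝ) ≤ C * Real.exp (H * n)) :
    ∃ C' : ℝ, ∀ n : ℕ, (pc X n : ℝ) ≤ C' * (n + 1) * Real.exp (H * n) := by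
  classical
  obtain ⟨D, hD, hF⟩ := FN_count hH h
  have hC : 0 ≤ C := by
    have := hZ 0
    simp at this
    exact le_trans (Nat.cast_nonneg _) this
  refine ⟨D + D * C, fun n => ?_⟩
  set Y : ℕ → Set (ℕ → Bool) := fun k => {x | x ∈ FN a b k ∧ shiftTail x k ∈ Z} with hY
  have hsub : (Pr_finite X n).toFinset ⊆ (Pr_finite (FN a b n) n).toFinset ∪
      (Finset.range n).biUnion (fun k => (Pr_finite (Y k) n).toFinset) := by
    intro l hl
    rw [Set.Finite.mem_toFinset] at hl
    obtain ⟨x, hx, rfl⟩ := hl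
    rw [Finset.mem_union, Finset.mem_biUnion]
    by_cases hxF : x ∈ FN a b n
    · left; rw [Set.Finite.mem_toFinset]; exact ⟨x, hxF, rfl⟩
    · right
      have hex : ∃ i, i < n ∧ toLex a < toLex (shiftTail x i) ∧
          toLex (shiftTail x i) < toLex b := by
        by_contra hc
        exact hxF fun i hi hh => hc ⟨i, hi, hh⟩
      have hs := Nat.find_spec hex
      refine ⟨Nat.find hex, Finset.mem_range.2 hs.1, ?_⟩
      rw [Set.Finite.mem_toFinset]
      refine ⟨x, ⟨fun i hi hh => Nat.find_min hex hi ⟨by omega, hh⟩, ?_⟩, rfl⟩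
      exact hXZ x hx _ hs.2.1 hs.2.2
  have hY2 : ∀ k ∈ Finset.range n, (pc (Y k) n : ℝ) ≤ D * C * Real.exp (H * n) := by
    intro k hk
    rw [Finset.mem_range] at hk
    obtain ⟨m, rfl⟩ := Nat.exists_eq_add_of_le hk.le
    have h1 : pc (Y k) (k + m) ≤ pc (FN a b k) k * pc Z m :=
      pc_split fun x hx => ⟨⟨x, hx.1, rfl⟩, ⟨_, hx.2, rfl⟩⟩
    have h2 : (pc (Y k) (k + m) : ℝ) ≤ pc (FN a b k) k * pc Z m := by exact_mod_cast h1
    calc _ ≤ _ := h2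
      _ ≤ (D * Real.exp (H * k)) * (C * Real.exp (H * m)) := by
        gcongr
        · exact hF k
        · exact hZ m
      _ = _ := by push_cast; rw [mul_add, Real.exp_add]; ring
  have h1 : pc X n ≤ pc (FN a b n) n + ∑ k ∈ Finset.range n, pc (Y k) n := by
    have := (Finset.card_le_card hsub).trans ((Finset.card_union_le _ _).trans
      (Nat.add_le_add_left Finset.card_biUnion_le _))
    simpa only [← Set.ncard_eq_toFinset_card, pc] using this
  have h2 : (pc X n : ℝ) ≤ pc (FN a b n) n + ∑ k ∈ Finset.range n, (pc (Y k) n : ℝ) := by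
    exact_mod_cast h1
  have h3 := Finset.sum_le_sum hY2
  rw [Finset.sum_const, Finset.card_range, nsmul_eq_mul] at h3
  have h4 := hF n
  have h5 := Real.exp_pos (H * n)
  have h6 : 0 ≤ D * n * Real.exp (H * n) := by positivity
  have h7 : 0 ≤ D * C * Real.exp (H * n) := by positivity
  nlinarith

/-! ### Free concatenations -/

lemma lemM1 {α β : List Bool} (hβ : β ≠ []) (h : toLex (perSeq β) < toLex (perSeq α)) :
    toLex (wordSeq β (perSeq α)) ≤ toLex (perSeq α) := by
  by_contra hc
  have := gt_perSeq_of hβ (not_le.1 hc)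
  order

lemma lemM2 {α β : List Bool} (hα : α ≠ []) (h : toLex (perSeq β) < toLex (perSeq α)) :
    toLex (perSeq β) ≤ toLex (wordSeq α (perSeq β)) := by
  by_contra hc
  have := lt_perSeq_of hα (not_le.1 hc)
  order

lemma sig_le {α β : List Bool} (hα : α ≠ []) (hβ : β ≠ [])
    (h : toLex (perSeq β) < toLex (perSeq α)) (j : ℕ → Bool) :
    toLex (sig α β j) ≤ toLex (perSeq α) := by
  have key : ∀ k, ∀ j : ℕ → Bool, toLex (wordSeq (wd α β j k) (perSeq α)) ≤ toLex (perSeq α) := by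
    intro k
    induction k with
    | zero => intro j; simp only [wd, wordSeq_nil]; exact le_rfl
    | succ k ih =>
      intro j
      rw [wd_succ, wordSeq_append]
      have h1 : toLex (wordSeq (blk α β (j 0)) (wordSeq (wd α β (shiftTail j 1) k) (perSeq α))) ≤
          toLex (wordSeq (blk α β (j 0)) (perSeq α)) := wordSeq_le_iff.2 (ih _)
      refine h1.trans ?_
      cases j 0
      · simp only [blk, Bool.false_eq_true, if_false]; rw [← perSeq_eq hα]
      · simp only [blk, if_true]; exact lemM1 hβ h
  by_contra hc
  obtain ⟨n, h1, h2, h3⟩ := (lt_iff_agr _ _).1 (not_le.1 hc)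
  have h4 : agr (n + 1) (sig α β j) (wordSeq (wd α β j (n + 1)) (perSeq α)) := by
    rw [sig_eq hα hβ (n + 1) j]
    exact (agr_wordSeq _ _ _).mono (wd_len hα hβ _ _)
  refine absurd ((lt_iff_agr _ _).2 ⟨n, h1.trans (h4.mono (Nat.le_succ n)), h2, ?_⟩)
    (not_lt.2 (key (n + 1) j))
  rw [← h4 n (Nat.lt_succ_self n), h3]

lemma le_sig {α β : List Bool} (hα : α ≠ []) (hβ : β ≠ [])
    (h : toLex (perSeq β) < toLex (perSeq α)) (j : ℕ → Bool) :
    toLex (perSeq β) ≤ toLex (sig α β j) := by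
  have key : ∀ k, ∀ j : ℕ → Bool, toLex (perSeq β) ≤ toLex (wordSeq (wd α β j k) (perSeq β)) := by
    intro k
    induction k with
    | zero => intro j; simp only [wd, wordSeq_nil]; exact le_rfl
    | succ k ih =>
      intro j
      rw [wd_succ, wordSeq_append]
      have h1 : toLex (wordSeq (blk α β (j 0)) (perSeq β)) ≤
        toLex (wordSeq (blk α β (j 0)) (wordSeq (wd α β (shiftTail j 1) k) (perSeq β))) :=
          wordSeq_le_iff.2 (ih _)
      refine le_trans ?_ h1
      cases j 0
      · simp only [blk, Bool.false_eq_true, if_false]; exact lemM2 hα h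
      · simp only [blk, if_true]; rw [← perSeq_eq hβ]
  by_contra hc
  obtain ⟨n, h1, h2, h3⟩ := (lt_iff_agr _ _).1 (not_le.1 hc)
  have h4 : agr (n + 1) (sig α β j) (wordSeq (wd α β j (n + 1)) (perSeq β)) := by
    rw [sig_eq hα hβ (n + 1) j]
    exact (agr_wordSeq _ _ _).mono (wd_len hα hβ _ _)
  refine absurd ((lt_iff_agr _ _).2 ⟨n, (h4.mono (Nat.le_succ n)).symm.trans h1, ?_, h3⟩)
    (not_lt.2 (key (n + 1) j))
  rw [← h4 n (Nat.lt_succ_self n), h2]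

lemma delay {α β : List Bool} (hα : α ≠ []) (hβ : β ≠ [])
    (h : toLex (perSeq β) < toLex (perSeq α)) {x y : ℕ → Bool}
    (hx : toLex (perSeq β) ≤ toLex x) (hy : toLex y ≤ toLex (perSeq α)) :
    ¬ agr (α.length + β.length) (wordSeq α x) (wordSeq β y) := by
  intro hagr
  set a := perSeq α with ha
  set b := perSeq β with hb
  have hM := lemM1 hβ h
  rw [← ha] at hM
  have ha' : a = wordSeq α a := perSeq_eq hα
  have hb' : b = wordSeq β b := perSeq_eq hβ
  have hne : wordSeq α (wordSeq β a) ≠ wordSeq β a := by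
    intro e
    have e1 : wordSeq β a = a := eq_perSeq hα e.symm
    have e2 : a = b := eq_perSeq hβ e1.symm
    rw [e2] at h
    exact lt_irrefl _ h
  have hlt : toLex (wordSeq β a) < toLex (wordSeq α (wordSeq β a)) := by
    by_contra hc
    have hc' := lt_of_le_of_ne (not_lt.1 hc) (fun e => hne (toLex.injective e))
    have := lt_perSeq_of hα hc'
    rw [← ha] at this
    order
  -- compare up to the position `α.length + β.length`
  have h1 : agr (α.length + β.length) (wordSeq α b) (wordSeq α (wordSeq β a)) := by
    rw [agr_wordSeq_add]
    conv => arg 2; rw [hb']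
    exact agr_wordSeq _ _ _
  have hnagr : ¬ agr (α.length + β.length) (wordSeq β a) (wordSeq α (wordSeq β a)) := by
    intro hh
    apply hne
    funext n
    by_cases hn : n < α.length + β.length
    · exact (hh n hn).symm
    · obtain ⟨m, rfl⟩ := Nat.exists_eq_add_of_le (not_lt.1 hn)
      conv_rhs => rw [ha', add_comm α.length, add_assoc, wordSeq_ge, wordSeq_ge]
      rw [add_assoc, wordSeq_ge, wordSeq_ge]
  have hlt2 : toLex (wordSeq β a) < toLex (wordSeq α b) := by
    by_contra hc
    -- then `α b ≤ β a < α β a`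
    exact hnagr ((sandwich h1 (not_lt.1 hc) hlt.le).symm.trans h1)
  have h2 : toLex (wordSeq β y) ≤ toLex (wordSeq β a) := wordSeq_le_iff.2 hy
  have h3 : toLex (wordSeq α b) ≤ toLex (wordSeq α x) := wordSeq_le_iff.2 hx
  have h4 := sandwich hagr.symm h2 (by order)
  have h5 := sandwich hagr.symm (by order) h3
  exact hnagr ((h4.symm.trans h5).trans h1)

lemma sig_delay {α β : List Bool} (hα : α ≠ []) (hβ : β ≠ [])
    (h : toLex (perSeq β) < toLex (perSeq α)) {j j' : ℕ → Bool} {k : ℕ} (hk : agr k j j')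
    (hd : j k ≠ j' k) :
    ¬ agr ((wd α β j k).length + (α.length + β.length)) (sig α β j) (sig α β j') := by
  have e := wd_congr α β k j j' hk
  rw [sig_eq hα hβ k j, sig_eq hα hβ k j', ← e, agr_wordSeq_add, sig_eq1 hα hβ (shiftTail j k),
    sig_eq1 hα hβ (shiftTail j' k)]
  have e1 : shiftTail j k 0 = j k := rfl
  have e2 : shiftTail j' k 0 = j' k := rfl
  rw [e1, e2]
  cases hj : j k <;> cases hj' : j' k
  · simp [hj, hj'] at hd
  · simp only [blk, Bool.false_eq_true, if_false, if_true]
    exact delay hα hβ h (le_sig hα hβ h _) (sig_le hα hβ h _)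
  · simp only [blk, Bool.false_eq_true, if_false, if_true]
    intro hc
    exact delay hα hβ h (le_sig hα hβ h _) (sig_le hα hβ h _) hc.symm
  · simp [hj, hj'] at hd

lemma tail_form {α β : List Bool} (hα : α ≠ []) (hβ : β ≠ []) (n : ℕ) : ∀ j : ℕ → Bool,
    ∃ d r t j', blk α β d = r ++ t ∧ shiftTail (sig α β j) n = wordSeq t (sig α β j') := by
  induction n using Nat.strong_induction_on with
  | _ n ih =>
    intro j
    have hl : 0 < (blk α β (j 0)).length := List.length_pos_iff.2 (blk_ne hα hβ _)
    by_cases hn : n < (blk α β (j 0)).length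
    · refine ⟨j 0, (blk α β (j 0)).take n, (blk α β (j 0)).drop n, shiftTail j 1,
        (List.take_append_drop _ _).symm, ?_⟩
      rw [sig_eq1 hα hβ j]
      conv_lhs => rw [← List.take_append_drop n (blk α β (j 0)), wordSeq_append]
      have e : ((blk α β (j 0)).take n).length = n := by rw [List.length_take]; omega
      have := shift_wordSeq ((blk α β (j 0)).take n)
        (wordSeq ((blk α β (j 0)).drop n) (sig α β (shiftTail j 1)))
      rwa [e] at this
    · obtain ⟨m, hm⟩ := Nat.exists_eq_add_of_le (not_lt.1 hn)
      obtain ⟨d, r, t, j', h1, h2⟩ := ih m (by omega) (shiftTail j 1)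
      refine ⟨d, r, t, j', h1, ?_⟩
      rw [hm, ← shift_shift, sig_eq1 hα hβ j, shift_wordSeq, h2]

/-! ### Small sets -/

lemma pc_monotone (d : Bool) {S : Set (ℕ → Bool)}
    (hS : ∀ x ∈ S, ∀ n, x n = d → x (n + 1) = d) (n : ℕ) : pc S n ≤ n + 1 := by
  have key : ∀ n, pc {x : ℕ → Bool | ∀ n, x n = d → x (n + 1) = d} n ≤ n + 1 := by
    intro n
    set X := {x : ℕ → Bool | ∀ n, x n = d → x (n + 1) = d} with hX
    induction n with
    | zero => simpa using pc_le_pow X 0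
    | succ n ih =>
      have hsub : Pr X (n + 1) ⊆ {pre (fun _ => d) (n + 1)} ∪ (fun l => (!d) :: l) '' Pr X n := by
        rintro _ ⟨x, hx, rfl⟩
        by_cases h0 : x 0 = d
        · left
          have : x = fun _ => d := by
            funext m
            induction m with
            | zero => exact h0
            | succ m ihm => exact hx m ihm
          rw [this]; rfl
        · right
          refine ⟨pre (shiftTail x 1) n, ⟨_, ?_, rfl⟩, ?_⟩
          · intro m hm
            have e : shiftTail x 1 (m + 1) = x (1 + m + 1) := rfl
            rw [e]; exact hx _ hm
          · show _ = pre x (n + 1)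
            rw [pre_succ]
            have : x 0 = !d := by cases hx0 : x 0 <;> cases d <;> simp_all
            rw [this]
      have hfin : ((fun l => (!d) :: l) '' Pr X n).Finite := (Pr_finite _ _).image _
      have h1 := Set.ncard_le_ncard hsub ((Set.finite_singleton _).union hfin)
      have h2 := Set.ncard_union_le {pre (fun _ => d) (n + 1)} ((fun l => (!d) :: l) '' Pr X n)
      have h3 := Set.ncard_image_le (f := fun l => (!d) :: l) (Pr_finite X n)
      rw [Set.ncard_singleton] at h2
      unfold pc at ih ⊢
      omega
  exact (pc_mono (fun x hx => hS x hx) n).trans (key n)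

lemma entropy_monotone {a b : ℕ → Bool} (d : Bool)
    (hS : ∀ x ∈ Omega a b, ∀ n, x n = d → x (n + 1) = d) : entropy a b ≤ 0 := by
  refine le_of_forall_pos_le_add fun ε hε => ?_
  rw [zero_add]
  refine ent_E2 (C := 1) hε fun n => ?_
  have h1 : (pc (Omega a b) n : ℝ) ≤ n + 1 := by exact_mod_cast pc_monotone d hS n
  have h2 : 1 ≤ Real.exp (ε * n) := Real.one_le_exp (by positivity)
  nlinarith [Nat.cast_nonneg (α := ℝ) n]

lemma agr_pow {s : List Bool} (hs : s ≠ []) (y : ℕ → Bool) (m : ℕ) :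
    agr m ((wordSeq s)^[m] y) (perSeq s) := by
  induction m with
  | zero => intro i hi; omega
  | succ m ih =>
    rw [Function.iterate_succ_apply', perSeq_eq hs]
    have hl : 0 < s.length := List.length_pos_iff.2 hs
    exact (agr_wordSeq_add.2 ih).mono (by omega)

lemma pc_pow {s : List Bool} (hs : s ≠ []) (y : ℕ → Bool) (n : ℕ) :
    pc (Set.range fun m => (wordSeq s)^[m] y) n ≤ n + 1 := by
  classical
  have hsub : Pr (Set.range fun m => (wordSeq s)^[m] y) n ⊆
      ↑((Finset.range (n + 1)).image fun m => pre ((wordSeq s)^[m] y) n) := by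
    rintro _ ⟨_, ⟨m, rfl⟩, rfl⟩
    simp only [Finset.coe_image, Set.mem_image, Finset.mem_coe, Finset.mem_range]
    by_cases hm : m < n + 1
    · exact ⟨m, hm, rfl⟩
    · refine ⟨n, by omega, ?_⟩
      rw [pre_eq_iff]
      exact (agr_pow hs y n).trans ((agr_pow hs y m).mono (by omega)).symm
  have h1 := Set.ncard_le_ncard hsub (Finset.finite_toSet _)
  rw [Set.ncard_coe_finset] at h1
  refine h1.trans (Finset.card_image_le.trans ?_)
  simp

lemma entropy_congr {a b a' b' : ℕ → Bool} (h : Omega a b = Omega a' b') :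
    entropy a b = entropy a' b' :=
  le_antisymm (entropy_mono h.subset) (entropy_mono h.symm.subset)

lemma pre_head {x : ℕ → Bool} {k : ℕ} (hk : 0 < k) : (pre x k).head? = some (x 0) := by
  obtain ⟨m, rfl⟩ : ∃ m, k = m + 1 := ⟨k - 1, by omega⟩
  rw [pre_succ]; rfl

/-- reduction when the two orbits meet -/
lemma red_meet {A B : ℕ → Bool} {s t : List Bool} (hs : s ≠ []) (ht : t ≠ [])
    (hA : A = wordSeq s B) (hB : B = wordSeq t A) (hAB : toLex A < toLex B)
    (h : 0 < entropy A B) :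
    Omega (perSeq s) (perSeq t) ⊆ Omega A B ∧ 0 < entropy (perSeq s) (perSeq t) := by
  have h1 : toLex (perSeq s) < toLex A := by
    apply lt_perSeq_of hs
    conv_rhs => rw [hA]
    exact wordSeq_lt_iff.2 hAB
  have h2 : toLex B < toLex (perSeq t) := by
    apply gt_perSeq_of ht
    conv_lhs => rw [hB]
    exact wordSeq_lt_iff.2 hAB
  refine ⟨Omega_mono h1.le h2.le, ?_⟩
  by_contra hc
  set H := entropy A B / 2 with hH
  have hH0 : 0 < H := by positivity
  set Z1 := Set.range fun m => (wordSeq s)^[m] B with hZ1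
  set Z2 := Set.range fun m => (wordSeq t)^[m] A with hZ2
  have hZ : ∀ n : ℕ, (pc (Z1 ∪ Z2) n : ℝ) ≤ (2 + 2 / H) * Real.exp (H * n) := by
    intro n
    have e1 : pc (Z1 ∪ Z2) n ≤ pc Z1 n + pc Z2 n := by
      unfold pc Pr
      rw [Set.image_union]
      exact Set.ncard_union_le _ _
    have e2 : pc Z1 n ≤ n + 1 := pc_pow hs B n
    have e3 : pc Z2 n ≤ n + 1 := pc_pow ht A n
    have e4 : (pc (Z1 ∪ Z2) n : ℝ) ≤ 2 * (n + 1) := by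
      have : pc (Z1 ∪ Z2) n ≤ 2 * (n + 1) := by omega
      exact_mod_cast this
    have e5 := Real.add_one_le_exp (H * n)
    have e6 : (2 + 2 / H) * (H * n + 1) ≤ (2 + 2 / H) * Real.exp (H * n) := by gcongr
    have e7 : (2 + 2 / H) * (H * n + 1) = 2 * H * n + 2 * n + 2 + 2 / H := by field_simp; ring
    have e8 : 0 ≤ 2 * H * n := by positivity
    have e9 : 0 ≤ 2 / H := by positivity
    linarith
  have hX : ∀ x ∈ Omega A B, ∀ n, toLex (perSeq s) < toLex (shiftTail x n) →
      toLex (shiftTail x n) < toLex (perSeq t) → shiftTail x n ∈ Z1 ∪ Z2 := by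
    intro x hx n h3 h4
    have hz := Omega_shift hx n
    set z := shiftTail x n with hzdef
    rcases Omega_or hz with h5 | h5
    · left
      by_contra hcz
      have : z = perSeq s := by
        refine iter_eq hs (fun z => z ∈ Omega A B ∧ z ∉ Z1 ∧ toLex (perSeq s) ≤ toLex z ∧
          toLex z ≤ toLex A) ?_ ⟨hz, hcz, h3.le, h5⟩
        rintro z ⟨k1, k2, k3, k4⟩
        rw [perSeq_eq hs] at k3
        rw [hA] at k4
        obtain ⟨y, hy, hy', k5, k6⟩ := between_word k3 k4
        have hyO : y ∈ Omega A B := hy' ▸ Omega_shift k1 _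
        have hyZ : y ∉ Z1 := by
          rintro ⟨m, hm⟩
          exact k2 ⟨m + 1, by simp only [Function.iterate_succ_apply'] at hm ⊢; rw [hm, ← hy]⟩
        have hyB : y ≠ B := fun e => hyZ ⟨0, e.symm⟩
        have hyB' : ¬ toLex B ≤ toLex y := fun e => hyB (toLex.injective (le_antisymm k6 e))
        exact ⟨y, hy, hyO, hyZ, k5, (Omega_or hyO).resolve_right hyB'⟩
      rw [this] at h3
      exact lt_irrefl _ h3
    · right
      by_contra hcz
      have : z = perSeq t := by
        refine iter_eq ht (fun z => z ∈ Omega A B ∧ z ∉ Z2 ∧ toLex B ≤ toLex z ∧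
          toLex z ≤ toLex (perSeq t)) ?_ ⟨hz, hcz, h5, h4.le⟩
        rintro z ⟨k1, k2, k3, k4⟩
        rw [perSeq_eq ht] at k4
        rw [hB] at k3
        obtain ⟨y, hy, hy', k5, k6⟩ := between_word k3 k4
        have hyO : y ∈ Omega A B := hy' ▸ Omega_shift k1 _
        have hyZ : y ∉ Z2 := by
          rintro ⟨m, hm⟩
          exact k2 ⟨m + 1, by simp only [Function.iterate_succ_apply'] at hm ⊢; rw [hm, ← hy]⟩
        have hyB : y ≠ A := fun e => hyZ ⟨0, e.symm⟩
        have hyB' : ¬ toLex y ≤ toLex A := fun e => hyB (toLex.injective (le_antisymm e k5))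
        exact ⟨y, hy, hyO, hyZ, (Omega_or hyO).resolve_left hyB', k6⟩
      rw [this] at h4
      exact lt_irrefl _ h4
  obtain ⟨C', hC'⟩ := counting hH0 (by linarith) hX hZ
  have := ent_E2 hH0 hC'
  linarith

/-! ### Key lemma -/

lemma exists_shift_eq {u v : List Bool} (hu : u ≠ []) (hv : v ≠ []) {i j : ℕ}
    (h : shiftTail (perSeq u) i = shiftTail (perSeq v) j) :
    ∃ k < u.length, shiftTail (perSeq u) k = perSeq v := by
  have hl : 0 < u.length := List.length_pos_iff.2 hu
  have hl' : 0 < v.length := List.length_pos_iff.2 hv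
  have hj : j ≤ v.length * j := Nat.le_mul_of_pos_left j hl'
  obtain ⟨l, hl2⟩ := Nat.exists_eq_add_of_le hj
  refine ⟨(i + l) % u.length, Nat.mod_lt _ hl, ?_⟩
  rw [← shift_perSeq_mod hu, ← shift_shift, h, shift_shift, ← hl2, shift_perSeq_mul hv]

lemma key_disjoint {u v : List Bool} (hu : u.head? = some false) (hv : v.head? = some true)
    (h : 0 < entropy (perSeq u) (perSeq v))
    (hA : perSeq u ∈ Omega (perSeq u) (perSeq v)) (hB : perSeq v ∈ Omega (perSeq u) (perSeq v))
    (hdis : ∀ i j, shiftTail (perSeq u) i ≠ shiftTail (perSeq v) j) :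
    ∃ α β : List Bool, α ≠ [] ∧ β ≠ [] ∧ List.Subperm α u ∧ List.Subperm β v ∧
      toLex (perSeq β) < toLex (perSeq α) ∧ ∀ j, sig α β j ∈ Omega (perSeq u) (perSeq v) := by
  classical
  have hu' := ne_nil_of_head hu
  have hv' := ne_nil_of_head hv
  have hA0 : perSeq u 0 = false := perSeq_zero hu
  have hB0 : perSeq v 0 = true := perSeq_zero hv
  have hlu : 0 < u.length := List.length_pos_iff.2 hu'
  have hlv : 0 < v.length := List.length_pos_iff.2 hv'
  set A := perSeq u with hAdef
  set B := perSeq v with hBdef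
  -- second letters
  have hlt : toLex (shiftTail B 1) < toLex (shiftTail A 1) := by
    by_contra hc
    have hc1 : A 1 = false ∨ B 1 = true := by
      by_contra hcc
      rw [not_or] at hcc
      exact hc (lt_of_zero (by simpa [shiftTail] using hcc.2) (by simpa [shiftTail] using hcc.1))
    rcases hc1 with h1 | h1
    · refine absurd (entropy_monotone false (a := A) (b := B) ?_) (not_le.2 h)
      intro x hx n hn
      by_contra hx1
      have hx1' : x (n + 1) = true := by simpa using hx1
      refine mem_Omega.1 hx n ⟨(lt_iff_agr _ _).2 ⟨1, ?_, h1, hx1'⟩, lt_of_zero hn hB0⟩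
      intro m hm
      obtain rfl : m = 0 := by omega
      rw [hA0]; exact hn.symm
    · refine absurd (entropy_monotone true (a := A) (b := B) ?_) (not_le.2 h)
      intro x hx n hn
      by_contra hx1
      have hx1' : x (n + 1) = false := by simpa using hx1
      refine mem_Omega.1 hx n ⟨lt_of_zero hA0 hn, (lt_iff_agr _ _).2 ⟨1, ?_, hx1', h1⟩⟩
      intro m hm
      obtain rfl : m = 0 := by omega
      rw [hB0]; exact hn
  obtain ⟨i0, hi0, hmax⟩ := Finset.exists_max_image
    ((Finset.range v.length).filter fun i => toLex (shiftTail B i) < toLex (shiftTail A 1))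
    (fun i => toLex (shiftTail B i)) ⟨1 % v.length, by
      rw [Finset.mem_filter, Finset.mem_range]
      exact ⟨Nat.mod_lt _ hlv, by rw [← shift_perSeq_mod hv']; exact hlt⟩⟩
  rw [Finset.mem_filter] at hi0
  set b1 := shiftTail B i0 with hb1
  obtain ⟨j0, hj0, hmin⟩ := Finset.exists_min_image
    ((Finset.range u.length).filter fun i => toLex b1 < toLex (shiftTail A i))
    (fun i => toLex (shiftTail A i)) ⟨1 % u.length, by
      rw [Finset.mem_filter, Finset.mem_range]
      exact ⟨Nat.mod_lt _ hlu, by rw [← shift_perSeq_mod hu']; exact hi0.2⟩⟩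
  rw [Finset.mem_filter] at hj0
  set a1 := shiftTail A j0 with ha1
  have hmin' : ∀ m, toLex b1 < toLex (shiftTail A m) → toLex a1 ≤ toLex (shiftTail A m) := by
    intro m hm
    rw [shift_perSeq_mod hu'] at hm ⊢
    exact hmin _ (Finset.mem_filter.2 ⟨Finset.mem_range.2 (Nat.mod_lt _ hlu), hm⟩)
  have ha1le : toLex a1 ≤ toLex (shiftTail A 1) := hmin' 1 hi0.2
  have hmax' : ∀ m, toLex (shiftTail B m) < toLex a1 → toLex (shiftTail B m) ≤ toLex b1 := by
    intro m hm
    have hm2 := lt_of_lt_of_le hm ha1le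
    rw [shift_perSeq_mod hv'] at hm2 ⊢
    exact hmax _ (Finset.mem_filter.2 ⟨Finset.mem_range.2 (Nat.mod_lt _ hlv), hm2⟩)
  have hpa : a1 = perSeq (pre a1 u.length) := shift_perSeq_eq_perSeq hu' j0
  have hpb : b1 = perSeq (pre b1 v.length) := shift_perSeq_eq_perSeq hv' i0
  have hα : pre a1 u.length ≠ [] := List.length_pos_iff.1 (by rw [pre_length]; exact hlu)
  have hβ : pre b1 v.length ≠ [] := List.length_pos_iff.1 (by rw [pre_length]; exact hlv)
  have hba : toLex (perSeq (pre b1 v.length)) < toLex (perSeq (pre a1 u.length)) := by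
    rw [← hpa, ← hpb]; exact hj0.2
  refine ⟨pre a1 u.length, pre b1 v.length, hα, hβ, (shift_perSeq_perm hu' j0).subperm,
    (shift_perSeq_perm hv' i0).subperm, hba, fun j => ?_⟩
  rw [mem_Omega]
  rintro n ⟨h1, h2⟩
  obtain ⟨d, r, t, j', h3, h4⟩ := tail_form hα hβ n j
  rw [h4] at h1 h2
  have hy1 := le_sig hα hβ hba j'
  have hy2 := sig_le hα hβ hba j'
  rw [← hpb] at hy1
  rw [← hpa] at hy2
  set y := sig (pre a1 u.length) (pre b1 v.length) j' with hy
  cases d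
  · simp only [blk, Bool.false_eq_true, if_false] at h3
    have he : wordSeq t a1 = shiftTail A (j0 + r.length) := by
      rw [← shift_shift, ← ha1]
      have e1 : a1 = wordSeq r (wordSeq t a1) := by
        rw [← wordSeq_append, ← h3]
        nth_rewrite 3 [hpa]
        rw [← perSeq_eq hα, ← hpa]
      conv_rhs => rw [e1]
      rw [shift_wordSeq]
    have h5 : toLex (wordSeq t y) ≤ toLex (wordSeq t a1) := wordSeq_le_iff.2 hy2
    have h6 : toLex B ≤ toLex (wordSeq t a1) := by
      refine (Omega_or ?_).resolve_left (not_le.2 (lt_of_lt_of_le h1 h5))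
      rw [he]; exact Omega_shift hA _
    obtain ⟨B', hB', hB'', h7, h8⟩ := between_word h2.le h6
    rw [hB'] at h2
    have h9 := wordSeq_lt_iff.1 h2
    have h10 : toLex B' < toLex a1 := by
      refine lt_of_le_of_ne h8 fun e => hdis j0 t.length ?_
      rw [← ha1, ← hB'']; exact (toLex.injective e).symm
    rw [hB''] at h10 h9
    have h11 := hmax' _ h10
    order
  · simp only [blk, if_true] at h3
    have he : wordSeq t b1 = shiftTail B (i0 + r.length) := by
      rw [← shift_shift, ← hb1]
      have e1 : b1 = wordSeq r (wordSeq t b1) := by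
        rw [← wordSeq_append, ← h3]
        nth_rewrite 3 [hpb]
        rw [← perSeq_eq hβ, ← hpb]
      conv_rhs => rw [e1]
      rw [shift_wordSeq]
    have h5 : toLex (wordSeq t b1) ≤ toLex (wordSeq t y) := wordSeq_le_iff.2 hy1
    have h6 : toLex (wordSeq t b1) ≤ toLex A := by
      refine (Omega_or ?_).resolve_right (not_le.2 (lt_of_le_of_lt h5 h2))
      rw [he]; exact Omega_shift hB _
    obtain ⟨A', hA', hA'', h7, h8⟩ := between_word h6 h1.le
    rw [hA'] at h1
    have h9 := wordSeq_lt_iff.1 h1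
    have h10 : toLex b1 < toLex A' := by
      refine lt_of_le_of_ne h7 fun e => hdis t.length i0 ?_
      rw [← hb1, ← hA'']; exact (toLex.injective e).symm
    rw [hA''] at h10 h9
    have h11 := hmin' _ h10
    order

lemma key_lemma (N : ℕ) : ∀ u v : List Bool, u.length + v.length ≤ N →
    u.head? = some false → v.head? = some true → 0 < entropy (perSeq u) (perSeq v) →
    ∃ α β : List Bool, α ≠ [] ∧ β ≠ [] ∧ List.Subperm α u ∧ List.Subperm β v ∧
      toLex (perSeq β) < toLex (perSeq α) ∧ ∀ j, sig α β j ∈ Omega (perSeq u) (perSeq v) := by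
  induction N with
  | zero =>
    intro u v hl hu hv _
    have : 0 < u.length := List.length_pos_iff.2 (ne_nil_of_head hu)
    omega
  | succ N ih =>
    intro u v hl hu hv h
    have hu' := ne_nil_of_head hu
    have hv' := ne_nil_of_head hv
    have hlu : 0 < u.length := List.length_pos_iff.2 hu'
    have hlv : 0 < v.length := List.length_pos_iff.2 hv'
    by_cases hA : perSeq u ∈ Omega (perSeq u) (perSeq v)
    swap
    · rw [mem_Omega] at hA
      simp only [not_forall, not_not] at hA
      obtain ⟨k, h1, h2⟩ := hA
      rw [shift_perSeq_mod hu'] at h1 h2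
      have hk := Nat.mod_lt k hlu
      set k' := k % u.length with hk'
      have hk0 : 0 < k' := by
        rcases Nat.eq_zero_or_pos k' with e | e
        · rw [e, shift_zero] at h1; exact absurd h1 (lt_irrefl _)
        · exact e
      obtain ⟨_, hO⟩ := red_left hk0 h1 h2
      obtain ⟨α, β, g1, g2, g3, g4, g5, g6⟩ := ih (pre (perSeq u) k') v (by rw [pre_length]; omega)
        (by rw [pre_head hk0, perSeq_zero hu]) hv (by rw [← entropy_congr hO]; exact h)
      exact ⟨α, β, g1, g2, g3.trans (pre_perSeq_initial hu' hk.le), g4, g5, by rw [hO]; exact g6⟩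
    by_cases hB : perSeq v ∈ Omega (perSeq u) (perSeq v)
    swap
    · rw [mem_Omega] at hB
      simp only [not_forall, not_not] at hB
      obtain ⟨k, h1, h2⟩ := hB
      rw [shift_perSeq_mod hv'] at h1 h2
      have hk := Nat.mod_lt k hlv
      set k' := k % v.length with hk'
      have hk0 : 0 < k' := by
        rcases Nat.eq_zero_or_pos k' with e | e
        · rw [e, shift_zero] at h2; exact absurd h2 (lt_irrefl _)
        · exact e
      obtain ⟨_, hO⟩ := red_right hk0 h1 h2
      obtain ⟨α, β, g1, g2, g3, g4, g5, g6⟩ := ih u (pre (perSeq v) k') (by rw [pre_length]; omega)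
        hu (by rw [pre_head hk0, perSeq_zero hv]) (by rw [← entropy_congr hO]; exact h)
      exact ⟨α, β, g1, g2, g3, g4.trans (pre_perSeq_initial hv' hk.le), g5, by rw [hO]; exact g6⟩
    by_cases hdis : ∀ i j, shiftTail (perSeq u) i ≠ shiftTail (perSeq v) j
    · exact key_disjoint hu hv h hA hB hdis
    · simp only [ne_eq, not_forall, not_not] at hdis
      obtain ⟨i, j, hij⟩ := hdis
      have hAB : toLex (perSeq u) < toLex (perSeq v) := lt_of_zero (perSeq_zero hu) (perSeq_zero hv)
      obtain ⟨k, hk, hkB⟩ := exists_shift_eq hu' hv' hij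
      obtain ⟨l, hl', hlA⟩ := exists_shift_eq hv' hu' hij.symm
      have hk0 : 0 < k := by
        rcases Nat.eq_zero_or_pos k with e | e
        · rw [e, shift_zero] at hkB; rw [hkB] at hAB; exact absurd hAB (lt_irrefl _)
        · exact e
      have hl0 : 0 < l := by
        rcases Nat.eq_zero_or_pos l with e | e
        · rw [e, shift_zero] at hlA; rw [hlA] at hAB; exact absurd hAB (lt_irrefl _)
        · exact e
      have e1 : perSeq u = wordSeq (pre (perSeq u) k) (perSeq v) := by
        conv_lhs => rw [← wordSeq_pre (perSeq u) k, hkB]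
      have e2 : perSeq v = wordSeq (pre (perSeq v) l) (perSeq u) := by
        conv_lhs => rw [← wordSeq_pre (perSeq v) l, hlA]
      obtain ⟨hO, hE⟩ := red_meet (List.length_pos_iff.1 (by rw [pre_length]; exact hk0))
        (List.length_pos_iff.1 (by rw [pre_length]; exact hl0)) e1 e2 hAB h
      obtain ⟨α, β, g1, g2, g3, g4, g5, g6⟩ := ih (pre (perSeq u) k) (pre (perSeq v) l)
        (by rw [pre_length, pre_length]; omega)
        (by rw [pre_head hk0, perSeq_zero hu]) (by rw [pre_head hl0, perSeq_zero hv]) hE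
      exact ⟨α, β, g1, g2, g3.trans (pre_perSeq_initial hu' hk.le),
        g4.trans (pre_perSeq_initial hv' hl'.le), g5, fun j => hO (g6 j)⟩

/-! ### Entropy -/

lemma pc_cat_le {u v α β : List Bool} (hu : u ≠ []) (hv : v ≠ []) (hα : α ≠ []) (hβ : β ≠ [])
    (h1 : α.length ≤ u.length) (h2 : β.length ≤ v.length)
    (h : toLex (perSeq β) < toLex (perSeq α)) {S : Set (ℕ → Bool)} (hS : ∀ j, sig α β j ∈ S)
    (n : ℕ) : pc (Set.range (sig u v)) n ≤ pc S (n + (α.length + β.length)) := by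
  have hex : ∀ w : List Bool, ∃ j, w ∈ Pr (Set.range (sig u v)) n → pre (sig u v j) n = w := by
    intro w
    by_cases hw : w ∈ Pr (Set.range (sig u v)) n
    · obtain ⟨_, ⟨j, rfl⟩, rfl⟩ := hw
      exact ⟨j, fun _ => rfl⟩
    · exact ⟨fun _ => false, fun hh => absurd hh hw⟩
  choose J hJ using hex
  refine Set.ncard_le_ncard_of_injOn (fun w => pre (sig α β (J w)) (n + (α.length + β.length)))
    (fun w _ => ⟨_, hS _, rfl⟩) ?_ (Pr_finite _ _)
  intro w hw w' hw' e
  by_contra hne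
  simp only [pre_eq_iff] at e
  have hJJ : J w ≠ J w' := by
    intro ee
    apply hne
    rw [← hJ w hw, ← hJ w' hw', ee]
  obtain ⟨k, hk, hd⟩ := exists_first_diff hJJ
  have hlen : (wd u v (J w) k).length < n := by
    by_contra hc
    apply hne
    rw [← hJ w hw, ← hJ w' hw', pre_eq_iff, sig_eq hu hv k (J w), sig_eq hu hv k (J w'),
      wd_congr u v k _ _ hk]
    refine (agr_wordSeq _ _ _).mono ?_
    rw [← wd_congr u v k _ _ hk]
    omega
  have hlen2 := wd_length_mono h1 h2 k (J w)
  exact sig_delay hα hβ h hk hd (e.mono (by omega))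

lemma entropy_main {u v α β : List Bool} (hu : u.head? = some false) (hv : v.head? = some true)
    (hα : α ≠ []) (hβ : β ≠ [])
    (h1 : α.length ≤ u.length) (h2 : β.length ≤ v.length)
    (hab : toLex (perSeq β) < toLex (perSeq α))
    (hS : ∀ j, sig α β j ∈ Omega (perSeq u) (perSeq v))
    (h : 0 < entropy (perSeq u) (perSeq v)) :
    entropy (perSeq u) (perSeq v) = entropy (wordSeq u (perSeq v)) (wordSeq v (perSeq u)) := by
  refine le_antisymm (entropy_mono (Omega_sub hu hv)) ?_
  refine le_of_forall_pos_le_add fun ε hε => ?_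
  set H := entropy (perSeq u) (perSeq v) + ε with hH
  have hH0 : 0 < H := by linarith
  obtain ⟨C, hC, hCn⟩ := ent_E1 hH0 (show entropy (perSeq u) (perSeq v) < H by linarith)
  set D := α.length + β.length with hD
  have hZ : ∀ n : ℕ, (pc (Set.range (sig u v)) n : ℝ) ≤ (C * Real.exp (H * D)) * Real.exp (H * n) := by
    intro n
    have e1 := pc_cat_le (ne_nil_of_head hu) (ne_nil_of_head hv) hα hβ h1 h2 hab hS n
    have e2 := hCn (n + D)
    have e3 : (pc (Set.range (sig u v)) n : ℝ) ≤ pc (Omega (perSeq u) (perSeq v)) (n + D) := by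
      exact_mod_cast e1
    refine e3.trans (e2.trans (le_of_eq ?_))
    push_cast
    rw [mul_add, Real.exp_add]; ring
  obtain ⟨C', hC'⟩ := counting (X := Omega (wordSeq u (perSeq v)) (wordSeq v (perSeq u))) hH0
    (show entropy (perSeq u) (perSeq v) < H by linarith)
    (fun x hx n g1 g2 => structure_cat hu hv (Omega_shift hx n) g1.le g2.le) hZ
  exact ent_E2 hH0 hC'


lemma contr {e : ℕ → ℝ} {p K : ℝ} (hp0 : 0 ≤ p) (hp1 : p < 1) (h : ∀ n, e n ≤ p * e (n + 1))
    (hK : ∀ n, e n ≤ K) (n : ℕ) : e n ≤ 0 := by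
  have key : ∀ m n, e n ≤ p ^ m * K := by
    intro m
    induction m with
    | zero => intro n; simpa using hK n
    | succ m ih =>
      intro n
      calc e n ≤ p * e (n + 1) := h n
        _ ≤ p * (p ^ m * K) := mul_le_mul_of_nonneg_left (ih _) hp0
        _ = _ := by ring
  have hlim : Tendsto (fun m : ℕ => p ^ m * K) atTop (𝓝 0) := by
    simpa using (tendsto_pow_atTop_nhds_zero_of_lt_one hp0 hp1).mul_const K
  exact ge_of_tendsto' hlim fun m => key m n

/-- product of inverse bases along a word -/
noncomputable def pw (q0 q1 : ℝ) (w : List Bool) : ℝ := (w.map fun d => (qb q0 q1 d)⁻¹).prod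

section proj

variable {q0 q1 : ℝ}

lemma qb_gt (h0 : 1 < q0) (h1 : 1 < q1) (d : Bool) : 1 < qb q0 q1 d := by
  cases d <;> simpa [qb]

lemma qb_ge_min (d : Bool) : min q0 q1 ≤ qb q0 q1 d := by
  cases d <;> simp [qb]

lemma qb_le_max (d : Bool) : qb q0 q1 d ≤ max q0 q1 := by
  cases d <;> simp [qb]

lemma pw_nil : pw q0 q1 [] = 1 := by simp [pw]

lemma pw_cons (d : Bool) (w : List Bool) : pw q0 q1 (d :: w) = (qb q0 q1 d)⁻¹ * pw q0 q1 w := by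
  simp [pw]

lemma pw_append (w w' : List Bool) : pw q0 q1 (w ++ w') = pw q0 q1 w * pw q0 q1 w' := by
  simp [pw]

lemma pw_pos (h0 : 1 < q0) (h1 : 1 < q1) (w : List Bool) : 0 < pw q0 q1 w := by
  induction w with
  | nil => simp [pw]
  | cons d w ih =>
    rw [pw_cons]
    have := qb_gt h0 h1 d
    positivity

lemma pw_le_one (h0 : 1 < q0) (h1 : 1 < q1) (w : List Bool) : pw q0 q1 w ≤ 1 := by
  induction w with
  | nil => simp [pw]
  | cons d w ih =>
    rw [pw_cons]
    have h2 := qb_gt h0 h1 d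
    have h3 : (qb q0 q1 d)⁻¹ ≤ 1 := inv_le_one_of_one_le₀ h2.le
    exact mul_le_one₀ h3 (pw_pos h0 h1 w).le ih

lemma pw_ge (h0 : 1 < q0) (h1 : 1 < q1) (w : List Bool) :
    (max q0 q1)⁻¹ ^ w.length ≤ pw q0 q1 w := by
  induction w with
  | nil => simp [pw]
  | cons d w ih =>
    rw [pw_cons, List.length_cons, pow_succ']
    have h2 := qb_gt h0 h1 d
    have h3 : (max q0 q1)⁻¹ ≤ (qb q0 q1 d)⁻¹ := inv_anti₀ (by linarith) (qb_le_max d)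
    have h4 : 0 < max q0 q1 := lt_max_of_lt_left (by linarith)
    exact mul_le_mul h3 ih (by positivity) (by positivity)

lemma pw_subperm (h0 : 1 < q0) (h1 : 1 < q1) {α u : List Bool} (h : List.Subperm α u) :
    pw q0 q1 u ≤ pw q0 q1 α := by
  obtain ⟨l', hp, hs⟩ := h
  obtain ⟨l, hl⟩ := hs.exists_perm_append
  have h2 : pw q0 q1 u = pw q0 q1 (l' ++ l) := (hl.map _).prod_eq
  have h3 : pw q0 q1 l' = pw q0 q1 α := (hp.map _).prod_eq
  rw [h2, pw_append, h3]
  exact mul_le_of_le_one_right (pw_pos h0 h1 α).le (pw_le_one h0 h1 l)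

lemma pw_wd (h0 : 1 < q0) (h1 : 1 < q1) {α β u v : List Bool} (hα : List.Subperm α u)
    (hβ : List.Subperm β v) (k : ℕ) : ∀ j : ℕ → Bool,
    pw q0 q1 (wd u v j k) ≤ pw q0 q1 (wd α β j k) := by
  induction k with
  | zero => intro j; exact le_rfl
  | succ k ih =>
    intro j
    rw [wd_succ, wd_succ, pw_append, pw_append]
    have h2 : pw q0 q1 (blk u v (j 0)) ≤ pw q0 q1 (blk α β (j 0)) := by
      cases j 0
      · simpa [blk] using pw_subperm h0 h1 hα
      · simpa [blk] using pw_subperm h0 h1 hβ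
    exact mul_le_mul h2 (ih _) (pw_pos h0 h1 _).le (pw_pos h0 h1 _).le

/-- digit value -/
noncomputable def dv (d : Bool) : ℝ := if d then 1 else 0

lemma prod_qb_ge (h0 : 1 < q0) (h1 : 1 < q1) (i : ℕ → Bool) (k : ℕ) :
    (min q0 q1) ^ k ≤ ∏ j ∈ Finset.range k, qb q0 q1 (i j) := by
  have hm : 0 < min q0 q1 := lt_min (by linarith) (by linarith)
  calc (min q0 q1) ^ k = ∏ _j ∈ Finset.range k, min q0 q1 := by simp
    _ ≤ _ := Finset.prod_le_prod (fun _ _ => hm.le) (fun _ _ => qb_ge_min _)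

lemma term_nonneg (h0 : 1 < q0) (h1 : 1 < q1) (i : ℕ → Bool) (k : ℕ) :
    0 ≤ (if i k then (1 : ℝ) else 0) / ∏ j ∈ Finset.range (k + 1), qb q0 q1 (i j) := by
  apply div_nonneg
  · split_ifs <;> norm_num
  · exact Finset.prod_nonneg fun j _ => by linarith [qb_gt h0 h1 (i j)]

lemma term_le (h0 : 1 < q0) (h1 : 1 < q1) (i : ℕ → Bool) (k : ℕ) :
    (if i k then (1 : ℝ) else 0) / ∏ j ∈ Finset.range (k + 1), qb q0 q1 (i j) ≤
      (min q0 q1)⁻¹ ^ (k + 1) := by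
  have hm : 0 < min q0 q1 := lt_min (by linarith) (by linarith)
  have h2 := prod_qb_ge h0 h1 i (k + 1)
  rw [inv_pow, ← one_div]
  apply div_le_div₀ zero_le_one _ (by positivity) h2
  split_ifs <;> norm_num

lemma summable_geo (h0 : 1 < q0) (h1 : 1 < q1) :
    Summable fun k : ℕ => (min q0 q1)⁻¹ ^ (k + 1) := by
  have hm : 1 < min q0 q1 := lt_min h0 h1
  exact (summable_nat_add_iff 1).2
    (summable_geometric_of_lt_one (by positivity) (inv_lt_one_of_one_lt₀ hm))

lemma summable_term (h0 : 1 < q0) (h1 : 1 < q1) (i : ℕ → Bool) : Summable fun k : ℕ =>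
    (if i k then (1 : ℝ) else 0) / ∏ j ∈ Finset.range (k + 1), qb q0 q1 (i j) :=
  Summable.of_nonneg_of_le (term_nonneg h0 h1 i) (term_le h0 h1 i) (summable_geo h0 h1)

lemma piE_nonneg (h0 : 1 < q0) (h1 : 1 < q1) (i : ℕ → Bool) : 0 ≤ piE q0 q1 i :=
  tsum_nonneg (term_nonneg h0 h1 i)

lemma piE_bdd (h0 : 1 < q0) (h1 : 1 < q1) (i : ℕ → Bool) :
    piE q0 q1 i ≤ ∑' k : ℕ, (min q0 q1)⁻¹ ^ (k + 1) :=
  (summable_term h0 h1 i).tsum_le_tsum (term_le h0 h1 i) (summable_geo h0 h1)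

lemma piE_shift (h0 : 1 < q0) (h1 : 1 < q1) (i : ℕ → Bool) :
    piE q0 q1 i = (qb q0 q1 (i 0))⁻¹ * (dv (i 0) + piE q0 q1 (shiftTail i 1)) := by
  unfold piE
  rw [(summable_term h0 h1 i).tsum_eq_zero_add, mul_add, ← tsum_mul_left]
  congr 1
  · simp [dv, div_eq_inv_mul]
  · congr 1
    funext k
    rw [Finset.prod_range_succ' _ (k + 1)]
    have e : ∀ m, i (m + 1) = shiftTail i 1 m := fun m => by simp [shiftTail, add_comm]
    simp only [e]
    rw [div_eq_inv_mul, div_eq_inv_mul, mul_inv]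
    ring

lemma piE_cont (h0 : 1 < q0) (h1 : 1 < q1) : Continuous (piE q0 q1) := by
  unfold piE
  refine continuous_tsum (u := fun k : ℕ => (min q0 q1)⁻¹ ^ (k + 1)) (fun k => ?_)
    (summable_geo h0 h1) (fun k i => ?_)
  · refine Continuous.div ?_ ?_ ?_
    · exact (continuous_of_discreteTopology (f := fun d : Bool => if d then (1 : ℝ) else 0)).comp
        (cont_ev k)
    · exact continuous_finsetProd _ fun j _ =>
        (continuous_of_discreteTopology (f := qb q0 q1)).comp (cont_ev j)
    · intro i
      exact (Finset.prod_pos fun j _ => by linarith [qb_gt h0 h1 (i j)]).ne'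
  · rw [Real.norm_of_nonneg (term_nonneg h0 h1 i k)]
    exact term_le h0 h1 i k

lemma piE_le (h0 : 1 < q0) (h1 : 1 < q1) (i : ℕ → Bool) : piE q0 q1 i ≤ 1 / (q1 - 1) := by
  have hm : 1 < min q0 q1 := lt_min h0 h1
  have hM : 0 < 1 / (q1 - 1) := by have : 0 < q1 - 1 := by linarith
                                   positivity
  have hMe : 1 + 1 / (q1 - 1) = q1 * (1 / (q1 - 1)) := by
    have : q1 - 1 ≠ 0 := by linarith
    field_simp; ring
  set M := 1 / (q1 - 1) with hMdef
  have := contr (e := fun n => max (piE q0 q1 (shiftTail i n) - M) 0) (p := (min q0 q1)⁻¹)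
    (K := ∑' k : ℕ, (min q0 q1)⁻¹ ^ (k + 1)) (by positivity) (inv_lt_one_of_one_lt₀ hm) ?_ ?_ 0
  · have h2 := (le_max_left _ _).trans this
    rw [shift_zero] at h2
    linarith
  · intro n
    have hmi : 0 < (min q0 q1)⁻¹ := by positivity
    apply max_le
    · rw [piE_shift h0 h1 (shiftTail i n), shift_shift]
      set d := shiftTail i n 0 with hd
      set X := piE q0 q1 (shiftTail i (n + 1)) with hX
      have hq := qb_gt h0 h1 d
      have h3 : (qb q0 q1 d)⁻¹ ≤ (min q0 q1)⁻¹ := inv_anti₀ (by linarith) (qb_ge_min d)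
      have h4 : (qb q0 q1 d)⁻¹ * (dv d + X) - M ≤ (qb q0 q1 d)⁻¹ * (X - M) := by
        have h5 : dv d + M ≤ qb q0 q1 d * M := by
          cases d
          · simp [dv, qb]; nlinarith
          · simp [dv, qb]; linarith
        have h6 : (qb q0 q1 d)⁻¹ * (dv d + M) ≤ M := by
          rw [inv_mul_le_iff₀ (by linarith)]; exact h5
        nlinarith
      have h7 : (qb q0 q1 d)⁻¹ * (X - M) ≤ (qb q0 q1 d)⁻¹ * max (X - M) 0 :=
        mul_le_mul_of_nonneg_left (le_max_left _ _) (by positivity)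
      have h8 : (qb q0 q1 d)⁻¹ * max (X - M) 0 ≤ (min q0 q1)⁻¹ * max (X - M) 0 :=
        mul_le_mul_of_nonneg_right h3 (le_max_right _ _)
      linarith
    · exact mul_nonneg hmi.le (le_max_right _ _)
  · intro n
    apply max_le
    · linarith [piE_bdd h0 h1 (shiftTail i n)]
    · exact tsum_nonneg fun k => by positivity

lemma piE_cons (h0 : 1 < q0) (h1 : 1 < q1) (d : Bool) (w : List Bool) (x : ℕ → Bool) :
    piE q0 q1 (wordSeq (d :: w) x) = (qb q0 q1 d)⁻¹ * (dv d + piE q0 q1 (wordSeq w x)) := by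
  rw [piE_shift h0 h1]
  have e1 : wordSeq (d :: w) x 0 = d := by simp [wordSeq]
  have e2 : shiftTail (wordSeq (d :: w) x) 1 = wordSeq w x := by
    have : d :: w = [d] ++ w := rfl
    rw [this, wordSeq_append]
    exact shift_wordSeq [d] _
  rw [e1, e2]

lemma piE_word (h0 : 1 < q0) (h1 : 1 < q1) (w : List Bool) (x y : ℕ → Bool) :
    piE q0 q1 (wordSeq w x) - piE q0 q1 (wordSeq w y) = pw q0 q1 w * (piE q0 q1 x - piE q0 q1 y) := by
  induction w with
  | nil => simp [wordSeq_nil, pw_nil]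
  | cons d w ih =>
    rw [piE_cons h0 h1, piE_cons h0 h1, pw_cons, mul_assoc, ← ih]
    ring

lemma piE_agr (h0 : 1 < q0) (h1 : 1 < q1) {x y : ℕ → Bool} {m : ℕ} (h : agr m x y) :
    piE q0 q1 x - piE q0 q1 y =
      pw q0 q1 (pre x m) * (piE q0 q1 (shiftTail x m) - piE q0 q1 (shiftTail y m)) := by
  rw [← piE_word h0 h1, wordSeq_pre, ← wordSeq_pre_of_agr h]

end proj

/-! ### Hausdorff dimension -/

section dims

variable {q0 q1 : ℝ}

lemma exists_y (h0 : 1 < q0) (h1 : 1 < q1) (a b : ℕ → Bool) : ∃ y ∈ Omega a b, y 0 = false ∧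
    ∀ x ∈ Omega a b, x 0 = false → piE q0 q1 x ≤ piE q0 q1 y := by
  have hc : IsCompact (Omega a b ∩ {x | x 0 = false}) :=
    ((isClosed_Omega a b).inter (isClosed_eq (cont_ev 0) continuous_const)).isCompact
  obtain ⟨y, hy, hm⟩ := hc.exists_isMaxOn ⟨_, zeros_mem a b, rfl⟩ (piE_cont h0 h1).continuousOn
  exact ⟨y, hy.1, hy.2, fun x hx hx0 => hm ⟨hx, hx0⟩⟩

lemma exists_z (h0 : 1 < q0) (h1 : 1 < q1) (a b : ℕ → Bool) : ∃ z ∈ Omega a b, z 0 = true ∧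
    ∀ x ∈ Omega a b, x 0 = true → piE q0 q1 z ≤ piE q0 q1 x := by
  have hc : IsCompact (Omega a b ∩ {x | x 0 = true}) :=
    ((isClosed_Omega a b).inter (isClosed_eq (cont_ev 0) continuous_const)).isCompact
  obtain ⟨y, hy, hm⟩ := hc.exists_isMinOn ⟨_, ones_mem a b, rfl⟩ (piE_cont h0 h1).continuousOn
  exact ⟨y, hy.1, hy.2, fun x hx hx0 => hm ⟨hx, hx0⟩⟩

lemma full_image (h0 : 1 < q0) (h1 : 1 < q1) {a b y z : ℕ → Bool} (ha : a 0 = false)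
    (hb : b 0 = true) (hy : y ∈ Omega a b) (hy0 : y 0 = false)
    (hym : ∀ x ∈ Omega a b, x 0 = false → piE q0 q1 x ≤ piE q0 q1 y)
    (hz : z ∈ Omega a b) (hz0 : z 0 = true)
    (hzm : ∀ x ∈ Omega a b, x 0 = true → piE q0 q1 z ≤ piE q0 q1 x)
    (hyz : piE q0 q1 z ≤ piE q0 q1 y) :
    Set.Icc 0 (1 / (q1 - 1)) ⊆ piE q0 q1 '' Omega a b := by
  have hya : toLex y ≤ toLex a := by
    rcases Omega_or hy with h | h
    · exact h
    · exact absurd (lt_of_zero hy0 hb) (not_lt.2 h)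
  have hzb : toLex b ≤ toLex z := by
    rcases Omega_or hz with h | h
    · exact absurd (lt_of_zero ha hz0) (not_lt.2 h)
    · exact h
  have hMe : q1 * (1 / (q1 - 1)) - 1 = 1 / (q1 - 1) := by
    have : q1 - 1 ≠ 0 := by linarith
    field_simp; ring
  have hpi := piE_le h0 h1
  set M := 1 / (q1 - 1) with hM
  set c := piE q0 q1 y with hc
  have hc1 : q0 * c ≤ M := by
    have := piE_shift h0 h1 y
    rw [hy0, ← hc] at this
    simp only [dv, qb, Bool.false_eq_true, if_false, zero_add] at this
    rw [this, mul_inv_cancel_left₀ (by linarith)]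
    exact hpi _
  have hc2 : 1 ≤ q1 * c := by
    have := piE_shift h0 h1 z
    rw [hz0] at this
    simp only [dv, qb, if_true] at this
    have h2 : q1 * piE q0 q1 z = 1 + piE q0 q1 (shiftTail z 1) := by
      rw [this, mul_inv_cancel_left₀ (by linarith)]
    have h3 := piE_nonneg h0 h1 (shiftTail z 1)
    nlinarith
  intro t ht
  let step : ℝ → ℝ := fun t => if c < t then q1 * t - 1 else q0 * t
  let X : ℕ → ℝ := fun n => step^[n] t
  have hX1 : ∀ n, X (n + 1) = step (X n) := fun n => Function.iterate_succ_apply' _ _ _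
  have hXr : ∀ n, 0 ≤ X n ∧ X n ≤ M := by
    intro n
    induction n with
    | zero => exact ht
    | succ n ih =>
      rw [hX1]
      obtain ⟨i1, i2⟩ := ih
      by_cases hcc : c < X n
      · simp only [step, if_pos hcc]
        constructor <;> nlinarith
      · simp only [step, if_neg hcc]
        constructor <;> nlinarith
  let w : ℕ → Bool := fun n => decide (c < X n)
  have hw0 : ∀ n, w n = false → X n ≤ c := fun n h => by simpa [w] using h
  have hw1 : ∀ n, w n = true → c < X n := fun n h => by simpa [w] using h
  have hXs : ∀ n, X n = (qb q0 q1 (w n))⁻¹ * (dv (w n) + X (n + 1)) := by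
    intro n
    rw [hX1]
    by_cases hcc : c < X n
    · have hwn : w n = true := by simp [w, hcc]
      rw [hwn]
      simp only [step, if_pos hcc, qb, dv, if_true]
      field_simp
      ring
    · have hwn : w n = false := by simpa [w] using hcc
      rw [hwn]
      simp only [step, if_neg hcc, qb, dv, Bool.false_eq_true, if_false]
      field_simp
      ring
  have hmin : 1 < min q0 q1 := lt_min h0 h1
  have hval : ∀ n, piE q0 q1 (shiftTail w n) = X n := by
    intro n
    have := contr (e := fun n => |piE q0 q1 (shiftTail w n) - X n|) (p := (min q0 q1)⁻¹)
      (K := M) (by positivity) (inv_lt_one_of_one_lt₀ hmin) ?_ ?_ n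
    · have h2 := abs_nonpos_iff.1 this
      linarith
    · intro n
      have e0 : shiftTail w n 0 = w n := rfl
      have hq := qb_gt h0 h1 (w n)
      have e1 : piE q0 q1 (shiftTail w n) - X n =
          (qb q0 q1 (w n))⁻¹ * (piE q0 q1 (shiftTail w (n + 1)) - X (n + 1)) := by
        rw [piE_shift h0 h1 (shiftTail w n), shift_shift, e0, hXs n]
        ring
      show |piE q0 q1 (shiftTail w n) - X n| ≤
        (min q0 q1)⁻¹ * |piE q0 q1 (shiftTail w (n + 1)) - X (n + 1)|
      rw [e1, abs_mul, abs_of_pos (by positivity)]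
      exact mul_le_mul_of_nonneg_right (inv_anti₀ (by linarith) (qb_ge_min _)) (abs_nonneg _)
    · intro n
      have a1 := piE_nonneg h0 h1 (shiftTail w n)
      have a2 := hpi (shiftTail w n)
      have a3 := hXr n
      exact abs_le.2 ⟨by linarith, by linarith⟩
  refine ⟨w, ?_, ?_⟩
  · rw [mem_Omega]
    rintro n ⟨ha', hb'⟩
    by_cases hn : w n = true
    · have hlt : toLex (shiftTail w n) < toLex z := lt_of_lt_of_le hb' hzb
      obtain ⟨m, hag, hm1, hm2⟩ := (lt_iff_agr _ _).1 hlt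
      have e := piE_agr h0 h1 hag
      rw [shift_shift, hval, hval] at e
      have g1 := hw0 _ hm1
      have g2 := hzm _ (Omega_shift hz m) hm2
      have g3 := pw_pos h0 h1 (pre (shiftTail w n) m)
      have g4 := pw_le_one h0 h1 (pre (shiftTail w n) m)
      have g5 := hw1 _ hn
      have g6 : pw q0 q1 (pre (shiftTail w n) m) * (X (n + m) - piE q0 q1 (shiftTail z m)) ≤
          pw q0 q1 (pre (shiftTail w n) m) * (c - piE q0 q1 z) :=
        mul_le_mul_of_nonneg_left (by linarith) g3.le
      have g7 : pw q0 q1 (pre (shiftTail w n) m) * (c - piE q0 q1 z) ≤ 1 * (c - piE q0 q1 z) :=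
        mul_le_mul_of_nonneg_right g4 (by linarith)
      linarith
    · have hn' : w n = false := by simpa using hn
      have hlt : toLex y < toLex (shiftTail w n) := lt_of_le_of_lt hya ha'
      obtain ⟨m, hag, hm1, hm2⟩ := (lt_iff_agr _ _).1 hlt
      have e := piE_agr h0 h1 hag
      rw [shift_shift, hval, hval] at e
      have g1 := hw1 _ hm2
      have g2 := hym _ (Omega_shift hy m) hm1
      have g3 := pw_pos h0 h1 (pre y m)
      have g5 := hw0 _ hn'
      have g6 : pw q0 q1 (pre y m) * (piE q0 q1 (shiftTail y m) - X (n + m)) < 0 :=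
        mul_neg_of_pos_of_neg g3 (by linarith)
      linarith
  · have := hval 0
    rw [shift_zero] at this
    exact this

lemma dimH_one (h1 : 1 < q1) {S : Set ℝ} (h : Set.Icc 0 (1 / (q1 - 1)) ⊆ S) : dimH S = 1 := by
  have hne : (interior S).Nonempty := by
    refine Set.Nonempty.mono (interior_mono h) ?_
    rw [interior_Icc]
    have : 0 < q1 - 1 := by linarith
    exact Set.nonempty_Ioo.2 (by positivity)
  simpa using Real.dimH_of_nonempty_interior hne

lemma dimH_range_le {ι : Type*} (F G : ι → ℝ) (C : NNReal)
    (h : ∀ j j', |G j - G j'| ≤ C * |F j - F j'|) : dimH (Set.range G) ≤ dimH (Set.range F) := by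
  classical
  rcases isEmpty_or_nonempty ι with hι | hι
  · simp [Set.range_eq_empty]
  let f : ℝ → ℝ := fun t => G (Function.invFun F t)
  have hf : ∀ j, f (F j) = G j := by
    intro j
    have e : F (Function.invFun F (F j)) = F j := Function.invFun_eq ⟨j, rfl⟩
    have := h (Function.invFun F (F j)) j
    rw [e, sub_self, abs_zero, mul_zero] at this
    have := abs_nonpos_iff.1 this
    show G (Function.invFun F (F j)) = G j
    linarith
  have hl : LipschitzOnWith C f (Set.range F) := by
    refine LipschitzOnWith.of_dist_le_mul ?_
    rintro _ ⟨j, rfl⟩ _ ⟨j', rfl⟩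
    rw [hf, hf, Real.dist_eq, Real.dist_eq]
    exact h j j'
  have e : Set.range G = f '' Set.range F := by
    rw [← Set.range_comp]
    congr 1
    funext j
    exact (hf j).symm
  rw [e]
  exact hl.dimH_image_le

/-- separation of the projections of two sequences of `Omega` -/
lemma piE_sep (h0 : 1 < q0) (h1 : 1 < q1) {a b : ℕ → Bool} {cy cz : ℝ}
    (hym : ∀ x ∈ Omega a b, x 0 = false → piE q0 q1 x ≤ cy)
    (hzm : ∀ x ∈ Omega a b, x 0 = true → cz ≤ piE q0 q1 x) (hyz : cy < cz)
    {x x' : ℕ → Bool} (hx : x ∈ Omega a b) (hx' : x' ∈ Omega a b) {N : ℕ} (hN : ¬ agr N x x') :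
    pw q0 q1 (pre x N) * (cz - cy) ≤ |piE q0 q1 x - piE q0 q1 x'| := by
  have hne : x ≠ x' := by
    rintro rfl
    exact hN fun _ _ => rfl
  obtain ⟨m, hm, hd⟩ := exists_first_diff hne
  have hmN : m ≤ N := by
    by_contra hc
    exact hN (hm.mono (by omega))
  obtain ⟨r, rfl⟩ := Nat.exists_eq_add_of_le hmN
  rw [piE_agr h0 h1 hm, abs_mul, abs_of_pos (pw_pos h0 h1 _), pre_add, pw_append]
  have hp := pw_pos h0 h1 (pre x m)
  have hp2 := pw_le_one h0 h1 (pre (shiftTail x m) r)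
  have hsep : cz - cy ≤ |piE q0 q1 (shiftTail x m) - piE q0 q1 (shiftTail x' m)| := by
    have e1 : shiftTail x m 0 = x m := rfl
    have e2 : shiftTail x' m 0 = x' m := rfl
    cases hxm : x m
    · have hxm' : x' m = true := by
        rw [hxm] at hd
        cases hq : x' m
        · exact absurd hq.symm hd
        · rfl
      have := hym _ (Omega_shift hx m) (e1.trans hxm)
      have := hzm _ (Omega_shift hx' m) (e2.trans hxm')
      rw [abs_sub_comm]
      exact le_trans (by linarith) (le_abs_self _)
    · have hxm' : x' m = false := by
        rw [hxm] at hd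
        cases hq : x' m
        · rfl
        · exact absurd hq.symm hd
      have := hzm _ (Omega_shift hx m) (e1.trans hxm)
      have := hym _ (Omega_shift hx' m) (e2.trans hxm')
      exact le_trans (by linarith) (le_abs_self _)
  calc pw q0 q1 (pre x m) * pw q0 q1 (pre (shiftTail x m) r) * (cz - cy)
      ≤ pw q0 q1 (pre x m) * 1 * (cz - cy) := by
        apply mul_le_mul_of_nonneg_right _ (by linarith)
        exact mul_le_mul_of_nonneg_left hp2 hp.le
    _ = pw q0 q1 (pre x m) * (cz - cy) := by ring
    _ ≤ _ := mul_le_mul_of_nonneg_left hsep hp.le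

lemma dimH_sig_le (h0 : 1 < q0) (h1 : 1 < q1) {u v α β : List Bool} (hu : u ≠ []) (hv : v ≠ [])
    (hα : α ≠ []) (hβ : β ≠ []) (hαu : List.Subperm α u) (hβv : List.Subperm β v)
    (hab : toLex (perSeq β) < toLex (perSeq α)) {a b : ℕ → Bool}
    (hS : ∀ j, sig α β j ∈ Omega a b) {cy cz : ℝ}
    (hym : ∀ x ∈ Omega a b, x 0 = false → piE q0 q1 x ≤ cy)
    (hzm : ∀ x ∈ Omega a b, x 0 = true → cz ≤ piE q0 q1 x) (hyz : cy < cz) :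
    dimH (Set.range fun j => piE q0 q1 (sig u v j)) ≤
      dimH (Set.range fun j => piE q0 q1 (sig α β j)) := by
  have hM : 0 < 1 / (q1 - 1) := by
    have : 0 < q1 - 1 := by linarith
    positivity
  have hpi := piE_le h0 h1
  set M := 1 / (q1 - 1) with hMdef
  set D := α.length + β.length with hD
  have hmax : 0 < max q0 q1 := lt_max_of_lt_left (by linarith)
  set κ := (max q0 q1)⁻¹ ^ D with hκ
  have hκ0 : 0 < κ := by positivity
  have hη : 0 < cz - cy := by linarith
  have hC : 0 ≤ M / (κ * (cz - cy)) := by positivity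
  refine dimH_range_le _ _ ⟨M / (κ * (cz - cy)), hC⟩ ?_
  intro j j'
  show _ ≤ M / (κ * (cz - cy)) * _
  by_cases hj : j = j'
  · subst hj; simp
  obtain ⟨k, hk, hd⟩ := exists_first_diff hj
  have hsd := sig_delay hα hβ hab hk hd
  have s1 := piE_sep h0 h1 hym hzm hyz (hS j) (hS j') hsd
  have s2 : pw q0 q1 (wd α β j k) * κ ≤
      pw q0 q1 (pre (sig α β j) ((wd α β j k).length + (α.length + β.length))) := by
    rw [pre_add, pw_append]
    conv_rhs => rw [sig_eq hα hβ k j, wordSeq_getD_word]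
    apply mul_le_mul_of_nonneg_left _ (pw_pos h0 h1 _).le
    have := pw_ge h0 h1 (pre (shiftTail (wordSeq (wd α β j k) (sig α β (shiftTail j k)))
      (wd α β j k).length) (α.length + β.length))
    rw [pre_length] at this
    exact this
  have s3 : |piE q0 q1 (sig u v j) - piE q0 q1 (sig u v j')| ≤ pw q0 q1 (wd u v j k) * M := by
    rw [sig_eq hu hv k j, sig_eq hu hv k j', ← wd_congr u v k j j' hk, piE_word h0 h1, abs_mul,
      abs_of_pos (pw_pos h0 h1 _)]
    apply mul_le_mul_of_nonneg_left _ (pw_pos h0 h1 _).le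
    have a1 := piE_nonneg h0 h1 (sig u v (shiftTail j k))
    have a2 := piE_nonneg h0 h1 (sig u v (shiftTail j' k))
    have a3 := hpi (sig u v (shiftTail j k))
    have a4 := hpi (sig u v (shiftTail j' k))
    exact abs_le.2 ⟨by linarith, by linarith⟩
  have s4 := pw_wd h0 h1 hαu hβv k j
  have s5 : pw q0 q1 (wd u v j k) * M ≤ pw q0 q1 (wd α β j k) * M :=
    mul_le_mul_of_nonneg_right s4 hM.le
  have s6 : pw q0 q1 (wd α β j k) * κ * (cz - cy) ≤
      |piE q0 q1 (sig α β j) - piE q0 q1 (sig α β j')| :=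
    le_trans (mul_le_mul_of_nonneg_right s2 hη.le) s1
  refine (s3.trans s5).trans ?_
  calc pw q0 q1 (wd α β j k) * M
      = M / (κ * (cz - cy)) * (pw q0 q1 (wd α β j k) * κ * (cz - cy)) := by
        field_simp
    _ ≤ _ := mul_le_mul_of_nonneg_left s6 hC

lemma dimH_cover (h0 : 1 < q0) (h1 : 1 < q1) {u v : List Bool} (hu : u.head? = some false)
    (hv : v.head? = some true) {d : ENNReal}
    (hd1 : dimH (piE q0 q1 '' Omega (perSeq u) (perSeq v)) ≤ d)
    (hd2 : dimH (Set.range fun j => piE q0 q1 (sig u v j)) ≤ d) :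
    dimH (piE q0 q1 '' Omega (wordSeq u (perSeq v)) (wordSeq v (perSeq u))) ≤ d := by
  let o : ℕ → Bool := fun _ => false
  let f : List Bool → ℝ → ℝ := fun w t =>
    piE q0 q1 (wordSeq w o) + pw q0 q1 w * (t - piE q0 q1 o)
  have hf : ∀ w x, piE q0 q1 (wordSeq w x) = f w (piE q0 q1 x) := by
    intro w x
    have := piE_word h0 h1 w x o
    show _ = piE q0 q1 (wordSeq w o) + pw q0 q1 w * (piE q0 q1 x - piE q0 q1 o)
    linarith
  have hlip : ∀ w, LipschitzWith 1 (f w) := by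
    intro w
    refine LipschitzWith.of_dist_le_mul fun s t => ?_
    rw [Real.dist_eq, Real.dist_eq]
    have e : f w s - f w t = pw q0 q1 w * (s - t) := by simp only [f]; ring
    rw [e, abs_mul, abs_of_pos (pw_pos h0 h1 w)]
    exact mul_le_mul_of_nonneg_right (by simpa using pw_le_one h0 h1 w) (abs_nonneg _)
  have hsub : piE q0 q1 '' Omega (wordSeq u (perSeq v)) (wordSeq v (perSeq u)) ⊆
      piE q0 q1 '' Omega (perSeq u) (perSeq v) ∪
        ⋃ w : List Bool, f w '' (Set.range fun j => piE q0 q1 (sig u v j)) := by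
    rintro _ ⟨x, hx, rfl⟩
    by_cases hxo : x ∈ Omega (perSeq u) (perSeq v)
    · exact Or.inl ⟨x, hxo, rfl⟩
    · right
      rw [mem_Omega] at hxo
      rw [not_forall] at hxo
      obtain ⟨n, hn⟩ := hxo
      obtain ⟨n1, n2⟩ := not_not.1 hn
      obtain ⟨j, hj⟩ := structure_cat hu hv (Omega_shift hx n) n1.le n2.le
      refine Set.mem_iUnion.2 ⟨pre x n, piE q0 q1 (sig u v j), ⟨j, rfl⟩, ?_⟩
      rw [← hf, hj, wordSeq_pre]
  refine (dimH_mono hsub).trans ?_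
  rw [dimH_union, dimH_iUnion]
  refine max_le hd1 (iSup_le fun w => ?_)
  exact ((hlip w).dimH_image_le _).trans hd2

lemma dim_main (h0 : 1 < q0) (h1 : 1 < q1) {u v α β : List Bool} (hu : u.head? = some false)
    (hv : v.head? = some true) (hα : α ≠ []) (hβ : β ≠ []) (hαu : List.Subperm α u)
    (hβv : List.Subperm β v) (hab : toLex (perSeq β) < toLex (perSeq α))
    (hS : ∀ j, sig α β j ∈ Omega (perSeq u) (perSeq v)) :
    dimH (piE q0 q1 '' Omega (perSeq u) (perSeq v)) =
      dimH (piE q0 q1 '' Omega (wordSeq u (perSeq v)) (wordSeq v (perSeq u))) := by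
  obtain ⟨y, hy, hy0, hym⟩ := exists_y h0 h1 (perSeq u) (perSeq v)
  obtain ⟨z, hz, hz0, hzm⟩ := exists_z h0 h1 (perSeq u) (perSeq v)
  have hsub := Set.image_mono (f := piE q0 q1) (Omega_sub hu hv)
  by_cases hyz : piE q0 q1 z ≤ piE q0 q1 y
  · have hI := full_image h0 h1 (perSeq_zero hu) (perSeq_zero hv) hy hy0 hym hz hz0 hzm hyz
    rw [dimH_one h1 hI, dimH_one h1 (hI.trans hsub)]
  · refine le_antisymm (dimH_mono hsub) (dimH_cover h0 h1 hu hv le_rfl ?_)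
    refine (dimH_sig_le h0 h1 (ne_nil_of_head hu) (ne_nil_of_head hv) hα hβ hαu hβv hab hS hym hzm
      (not_le.1 hyz)).trans (dimH_mono ?_)
    rintro _ ⟨j, rfl⟩
    exact ⟨_, hS j, rfl⟩

end dims

/-- Theorem 5, first part: for finite words `u ∈ 0{0,1}^*`, `v ∈ 1{0,1}^*` with
`h(Ω_{u^∞,v^∞}) > 0`, one has `dim_H π_{q₀,q₁}(Ω_{u^∞,v^∞}) = dim_H π_{q₀,q₁}(Ω_{uv^∞,vu^∞})`
for all `q₀,q₁ > 1`, hence `h(Ω_{u^∞,v^∞}) = h(Ω_{uv^∞,vu^∞})`. -/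
theorem stmt9 (u v : List Bool) (hu : u.head? = some false) (hv : v.head? = some true)
    (h : 0 < entropy (perSeq u) (perSeq v)) :
    (∀ q0 q1 : ℝ, 1 < q0 → 1 < q1 →
      dimH (piE q0 q1 '' Omega (perSeq u) (perSeq v)) =
        dimH (piE q0 q1 '' Omega (wordSeq u (perSeq v)) (wordSeq v (perSeq u)))) ∧
    entropy (perSeq u) (perSeq v) =
      entropy (wordSeq u (perSeq v)) (wordSeq v (perSeq u)) := by
  obtain ⟨α, β, hα, hβ, hαu, hβv, hab, hS⟩ := key_lemma (u.length + v.length) u v le_rfl hu hv h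
  exact ⟨fun q0 q1 h0 h1 => dim_main h0 h1 hu hv hα hβ hαu hβv hab hS,
    entropy_main hu hv hα hβ hαu.length_le hβv.length_le hab hS h⟩
end

section
/- Let (a,b) ∈ W, let q₀,q₁ > 1, and let s > 0 satisfy lim_{n→∞} (1/n) log Σ_{i₁⋯iₙ ∈ L_{a,b,n}} (q_{i₁}⋯q_{iₙ})^{−s} = 0. Then π_{q₀^s,q₁^s}(a) = π_{q₀^s,q₁^s}(b), and π_{q₀^t,q₁^t}(a) ≠ π_{q₀^t,q₁^t}(b) for every t > s; that is, s is the maximal root of the equation π_{q₀^s,q₁^s}(a) = π_{q₀^s,q₁^s}(b). -/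
open Filter Topology

namespace S12

open Classical in
theorem lexLt_iff (u v : ℕ → Bool) : lexLt u v ↔ toLex u < toLex v := Iff.rfl

theorem lexLt_trans {u v w : ℕ → Bool} (h : lexLt u v) (h' : lexLt v w) : lexLt u w := by
  rw [lexLt_iff] at *; exact h.trans h'

theorem le_lt_trans {u v w : ℕ → Bool} (h : ¬ lexLt v u) (h' : lexLt v w) : lexLt u w := by
  rw [lexLt_iff] at *; exact lt_of_le_of_lt (not_lt.1 h) h'

theorem lt_le_trans {u v w : ℕ → Bool} (h : lexLt u v) (h' : ¬ lexLt w v) : lexLt u w := by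
  rw [lexLt_iff] at *; exact lt_of_lt_of_le h (not_lt.1 h')

theorem lexLt_irrefl (u : ℕ → Bool) : ¬ lexLt u u := by
  rw [lexLt_iff]; exact lt_irrefl _

theorem lexLt_asymm {u v : ℕ → Bool} (h : lexLt u v) : ¬ lexLt v u := by
  rw [lexLt_iff] at *; exact not_lt.2 h.le

/-- prepend a digit -/
def consS (d : Bool) (u : ℕ → Bool) : ℕ → Bool
  | 0 => d
  | k + 1 => u k

theorem consS_shift (v : ℕ → Bool) : consS (v 0) (shiftTail v 1) = v := by
  funext k
  cases k with
  | zero => rfl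
  | succ k => simp [consS, shiftTail, add_comm]

theorem shift_consS (d : Bool) (u : ℕ → Bool) (n : ℕ) :
    shiftTail (consS d u) (n + 1) = shiftTail u n := by
  funext k
  simp only [shiftTail]
  rw [show n + 1 + k = (n + k) + 1 by ring]; rfl

theorem shift_zero (u : ℕ → Bool) : shiftTail u 0 = u := by
  funext k; simp [shiftTail]

theorem shift_shift (u : ℕ → Bool) (m n : ℕ) :
    shiftTail (shiftTail u m) n = shiftTail u (m + n) := by
  funext k; simp [shiftTail, add_assoc]

theorem lexLt_cons (d : Bool) (u v : ℕ → Bool) :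
    lexLt (consS d u) (consS d v) ↔ lexLt u v := by
  constructor
  · rintro ⟨n, h1, h2⟩
    cases n with
    | zero => exact absurd h2 (lt_irrefl _)
    | succ n => exact ⟨n, fun m hm => h1 (m + 1) (by omega), h2⟩
  · rintro ⟨n, h1, h2⟩
    refine ⟨n + 1, fun m hm => ?_, h2⟩
    cases m with
    | zero => rfl
    | succ m => exact h1 m (by omega)

theorem lexLt_of_zero {u v : ℕ → Bool} (hu : u 0 = false) (hv : v 0 = true) : lexLt u v :=
  ⟨0, fun m hm => absurd hm (Nat.not_lt_zero m), by rw [hu, hv]; decide⟩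

/-- generic comparison after a common prefix -/
theorem lexLt_shift {u v : ℕ → Bool} (n : ℕ) (h : ∀ k < n, u k = v k) :
    lexLt u v ↔ lexLt (shiftTail u n) (shiftTail v n) := by
  constructor
  · rintro ⟨m, h1, h2⟩
    have hm : n ≤ m := by
      by_contra hc
      rw [h m (by omega)] at h2
      exact lt_irrefl _ h2
    refine ⟨m - n, fun k hk => h1 _ (by omega), ?_⟩
    simpa [shiftTail, show n + (m - n) = m by omega] using h2
  · rintro ⟨m, h1, h2⟩
    refine ⟨n + m, fun k hk => ?_, h2⟩
    by_cases hk' : k < n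
    · exact h k hk'
    · have := h1 (k - n) (by omega)
      simpa [shiftTail, show n + (k - n) = k by omega] using this

theorem Omega_shift {a b u : ℕ → Bool} (hu : u ∈ Omega a b) (n : ℕ) :
    shiftTail u n ∈ Omega a b := by
  intro m
  rw [shift_shift]
  exact hu (n + m)

theorem Omega_of_cons {a b u : ℕ → Bool} {d : Bool} (hu : consS d u ∈ Omega a b) :
    u ∈ Omega a b := by
  have := Omega_shift hu 1
  rwa [show (1 : ℕ) = 0 + 1 from rfl, shift_consS, shift_zero] at this

theorem le_a {a b u : ℕ → Bool} (hb : b 0 = true) (hu : u ∈ Omega a b) (h0 : u 0 = false) :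
    ¬ lexLt a u := by
  intro h
  have := hu 0
  rw [shift_zero] at this
  exact this ⟨h, lexLt_of_zero h0 hb⟩

theorem ge_b {a b u : ℕ → Bool} (ha : a 0 = false) (hu : u ∈ Omega a b) (h0 : u 0 = true) :
    ¬ lexLt u b := by
  intro h
  have := hu 0
  rw [shift_zero] at this
  exact this ⟨lexLt_of_zero ha h0, h⟩

theorem cons_mem {a b u : ℕ → Bool} {d : Bool} (hu : u ∈ Omega a b)
    (h : ¬ (lexLt a (consS d u) ∧ lexLt (consS d u) b)) : consS d u ∈ Omega a b := by
  intro n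
  cases n with
  | zero => rwa [shift_zero]
  | succ n => rw [shift_consS]; exact hu n

theorem cons_false_mem {a b u : ℕ → Bool} (hb : b 0 = true) (hu : u ∈ Omega a b) :
    consS false u ∈ Omega a b ↔ ¬ lexLt a (consS false u) :=
  ⟨fun h => le_a hb h rfl, fun h => cons_mem hu (fun h' => h h'.1)⟩

theorem cons_true_mem {a b u : ℕ → Bool} (ha : a 0 = false) (hu : u ∈ Omega a b) :
    consS true u ∈ Omega a b ↔ ¬ lexLt (consS true u) b :=
  ⟨fun h => ge_b ha h rfl, fun h => cons_mem hu (fun h' => h h'.2)⟩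

open Classical in
/-- transfer operator -/
noncomputable def P (Om : Set (ℕ → Bool)) (x : Bool → ℝ) :
    ((ℕ → Bool) → ℝ) →ₗ[ℝ] ((ℕ → Bool) → ℝ) where
  toFun f u := (if consS false u ∈ Om then x false * f (consS false u) else 0)
    + (if consS true u ∈ Om then x true * f (consS true u) else 0)
  map_add' f g := by
    funext u
    simp only [Pi.add_apply]
    split_ifs <;> ring
  map_smul' c f := by
    funext u
    simp only [Pi.smul_apply, smul_eq_mul, RingHom.id_apply]
    split_ifs <;> ring

open Classical in
theorem P_apply (Om : Set (ℕ → Bool)) (x : Bool → ℝ) (f : (ℕ → Bool) → ℝ) (u : ℕ → Bool) :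
    P Om x f u = (if consS false u ∈ Om then x false * f (consS false u) else 0)
    + (if consS true u ∈ Om then x true * f (consS true u) else 0) := rfl

theorem P_mono {Om : Set (ℕ → Bool)} {x : Bool → ℝ} (hx : ∀ d, 0 < x d)
    {f g : (ℕ → Bool) → ℝ} (h : ∀ u ∈ Om, f u ≤ g u) (u : ℕ → Bool) :
    P Om x f u ≤ P Om x g u := by
  classical
  rw [P_apply, P_apply]
  apply add_le_add
  · split_ifs with h1
    · exact mul_le_mul_of_nonneg_left (h _ h1) (hx _).le
    · exact le_rfl
  · split_ifs with h1
    · exact mul_le_mul_of_nonneg_left (h _ h1) (hx _).le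
    · exact le_rfl

theorem Pn_mono {Om : Set (ℕ → Bool)} {x : Bool → ℝ} (hx : ∀ d, 0 < x d) (n : ℕ) :
    ∀ {f g : (ℕ → Bool) → ℝ} (_ : ∀ u ∈ Om, f u ≤ g u) (u : ℕ → Bool) (_ : u ∈ Om),
    (P Om x ^ n) f u ≤ (P Om x ^ n) g u := by
  induction n with
  | zero => intro f g h u hu; simpa using h u hu
  | succ n ih =>
    intro f g h u hu
    rw [pow_succ, Module.End.mul_apply, Module.End.mul_apply]
    exact ih (fun v _ => P_mono hx h v) u hu

theorem Pn_congr {Om : Set (ℕ → Bool)} {x : Bool → ℝ} (hx : ∀ d, 0 < x d) (n : ℕ)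
    {f g : (ℕ → Bool) → ℝ} (h : ∀ u ∈ Om, f u = g u) (u : ℕ → Bool) (hu : u ∈ Om) :
    (P Om x ^ n) f u = (P Om x ^ n) g u :=
  le_antisymm (Pn_mono hx n (fun v hv => (h v hv).le) u hu)
    (Pn_mono hx n (fun v hv => (h v hv).ge) u hu)

/-- `P^n 1` -/
noncomputable def pn (Om : Set (ℕ → Bool)) (x : Bool → ℝ) (n : ℕ) (u : ℕ → Bool) : ℝ :=
  (P Om x ^ n) (fun _ => 1) u

theorem pn_nonneg {Om : Set (ℕ → Bool)} {x : Bool → ℝ} (hx : ∀ d, 0 < x d) (n : ℕ)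
    (u : ℕ → Bool) (hu : u ∈ Om) : 0 ≤ pn Om x n u := by
  have := Pn_mono (Om := Om) hx n (f := 0) (g := fun _ => 1) (fun v _ => zero_le_one) u hu
  simpa [pn] using this

theorem Pn_const {Om : Set (ℕ → Bool)} {x : Bool → ℝ} (n : ℕ) (c : ℝ) (u : ℕ → Bool) :
    (P Om x ^ n) (fun _ => c) u = c * pn Om x n u := by
  have : (fun _ : ℕ → Bool => c) = c • (fun _ : ℕ → Bool => (1 : ℝ)) := by
    funext u; simp
  rw [this, map_smul]; rfl

theorem Pn_abs_le {Om : Set (ℕ → Bool)} {x : Bool → ℝ} (hx : ∀ d, 0 < x d) (n : ℕ)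
    {f : (ℕ → Bool) → ℝ} {K : ℝ} (h : ∀ u ∈ Om, |f u| ≤ K) (u : ℕ → Bool) (hu : u ∈ Om) :
    |(P Om x ^ n) f u| ≤ K * pn Om x n u := by
  rw [abs_le, ← neg_mul, ← Pn_const, ← Pn_const]
  exact ⟨Pn_mono hx n (fun v hv => (abs_le.1 (h v hv)).1) u hu,
    Pn_mono hx n (fun v hv => (abs_le.1 (h v hv)).2) u hu⟩

theorem iterate_id {Om : Set (ℕ → Bool)} {x : Bool → ℝ} (hx : ∀ d, 0 < x d)
    {h : (ℕ → Bool) → ℝ} {δ : ℝ} (hh : ∀ u ∈ Om, h u - P Om x h u = δ) (n : ℕ)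
    (u : ℕ → Bool) (hu : u ∈ Om) :
    h u = (P Om x ^ n) h u + δ * ∑ k ∈ Finset.range n, pn Om x k u := by
  induction n with
  | zero => simp
  | succ n ih =>
    rw [Finset.sum_range_succ, pow_succ, Module.End.mul_apply]
    have : (P Om x ^ n) (P Om x h) u = (P Om x ^ n) (h - fun _ => δ) u := by
      apply Pn_congr hx n _ u hu
      intro v hv
      have := hh v hv
      simp only [Pi.sub_apply]; linarith
    rw [this, map_sub, Pi.sub_apply, Pn_const]
    linarith

/-- bounded Green function implies exponential decay -/
theorem decay {Om : Set (ℕ → Bool)} {x : Bool → ℝ} (hx : ∀ d, 0 < x d) {C : ℝ} (hC : 1 ≤ C)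
    (hS : ∀ u ∈ Om, ∀ n, ∑ k ∈ Finset.range n, pn Om x k u ≤ C)
    (n : ℕ) (u : ℕ → Bool) (hu : u ∈ Om) : pn Om x n u ≤ C * (1 - 1 / C) ^ n := by
  have hC0 : 0 < C := by linarith
  have hθ : 0 ≤ 1 - 1 / C := by
    rw [sub_nonneg, div_le_one hC0]; exact hC
  -- tails
  have tail : ∀ m M, ∑ k ∈ Finset.range M, pn Om x (m + k) u ≤ C * pn Om x m u := by
    intro m M
    have h1 : ∑ k ∈ Finset.range M, pn Om x (m + k) u
        = (P Om x ^ m) (∑ k ∈ Finset.range M, (P Om x ^ k) (fun _ => 1)) u := by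
      rw [map_sum, Finset.sum_apply]
      refine Finset.sum_congr rfl fun k _ => ?_
      unfold pn
      rw [pow_add, Module.End.mul_apply]
    rw [h1, ← Pn_const]
    apply Pn_mono hx m _ u hu
    intro v hv
    rw [Finset.sum_apply]
    exact hS v hv M
  have key : ∀ m M, ∑ k ∈ Finset.range M, pn Om x (m + k) u ≤ C * (1 - 1 / C) ^ m := by
    intro m
    induction m with
    | zero => intro M; simpa using hS u hu M
    | succ m ih =>
      intro M
      have h1 := ih (M + 1)
      have h2 := tail m (M + 1)
      rw [Finset.sum_range_succ'] at h1 h2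
      simp only [add_zero] at h1 h2
      have e : ∑ k ∈ Finset.range M, pn Om x (m + (k + 1)) u
          = ∑ k ∈ Finset.range M, pn Om x (m + 1 + k) u :=
        Finset.sum_congr rfl fun k _ => by rw [show m + (k + 1) = m + 1 + k by ring]
      rw [e] at h1 h2
      set T := ∑ k ∈ Finset.range M, pn Om x (m + 1 + k) u
      have h3 : (T + pn Om x m u) / C ≤ pn Om x m u := by
        rw [div_le_iff₀ hC0]; linarith
      have h4 : T ≤ (1 - 1 / C) * (T + pn Om x m u) := by
        have : (1 - 1 / C) * (T + pn Om x m u) = (T + pn Om x m u) - (T + pn Om x m u) / C := by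
          ring
        rw [this]; linarith
      calc T ≤ (1 - 1 / C) * (T + pn Om x m u) := h4
        _ ≤ (1 - 1 / C) * (C * (1 - 1 / C) ^ m) := mul_le_mul_of_nonneg_left h1 hθ
        _ = C * (1 - 1 / C) ^ (m + 1) := by ring
  simpa using key n 1

/-- concatenation -/
def app {n : ℕ} (w : Fin n → Bool) (u : ℕ → Bool) : ℕ → Bool :=
  fun k => if h : k < n then w ⟨k, h⟩ else u (k - n)

theorem app_zero (w : Fin 0 → Bool) (u : ℕ → Bool) : app w u = u := by
  funext k; simp [app]

theorem app_cons {n : ℕ} (d : Bool) (w : Fin n → Bool) (u : ℕ → Bool) :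
    app (Fin.cons d w : Fin (n + 1) → Bool) u = consS d (app w u) := by
  funext k
  cases k with
  | zero => simp [app, consS]
  | succ k =>
    simp only [app, consS, Nat.add_lt_add_iff_right, Nat.add_sub_add_right]
    split_ifs with h
    · exact Fin.cons_succ (α := fun _ => Bool) d w ⟨k, h⟩
    · rfl

open Classical in
theorem Pn_explicit {a b : ℕ → Bool} (x : Bool → ℝ) (n : ℕ) :
    ∀ (f : (ℕ → Bool) → ℝ) (u : ℕ → Bool) (_ : u ∈ Omega a b),
    (P (Omega a b) x ^ n) f u = ∑ w : Fin n → Bool,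
      if app w u ∈ Omega a b then (∏ j, x (w j)) * f (app w u) else 0 := by
  induction n with
  | zero => intro f u hu; simp [app_zero, hu]
  | succ n ih =>
    intro f u hu
    rw [pow_succ, Module.End.mul_apply, ih _ u hu,
      ← (Fin.consEquiv (fun _ : Fin (n + 1) => Bool)).sum_comp, Fintype.sum_prod_type_right]
    refine Finset.sum_congr rfl fun w _ => ?_
    have hc : ∀ d, app ((Fin.consEquiv (fun _ : Fin (n + 1) => Bool)) (d, w)) u
        = consS d (app w u) := fun d => app_cons d w u
    simp only [hc]
    simp only [Fin.consEquiv_apply, Fintype.sum_bool, Fin.prod_univ_succ, Fin.cons_zero,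
      Fin.cons_succ, P_apply]
    by_cases h : app w u ∈ Omega a b
    · rw [if_pos h]
      split_ifs <;> ring
    · rw [if_neg h, if_neg (fun h' => h (Omega_of_cons h')),
        if_neg (fun h' => h (Omega_of_cons h'))]
      simp

theorem mem_Lwords {a b : ℕ → Bool} {n : ℕ} {w : Fin n → Bool} :
    w ∈ Lwords a b n ↔ ∃ i ∈ Omega a b, ∀ k : Fin n, i k.1 = w k := by
  simp [Lwords]

/-- partition sum -/
noncomputable def Z (a b : ℕ → Bool) (x : Bool → ℝ) (n : ℕ) : ℝ :=
  ∑ w ∈ Lwords a b n, ∏ j, x (w j)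

theorem pn_le_Z {a b : ℕ → Bool} {x : Bool → ℝ} (hx : ∀ d, 0 < x d) (n : ℕ)
    (u : ℕ → Bool) (hu : u ∈ Omega a b) : pn (Omega a b) x n u ≤ Z a b x n := by
  classical
  unfold pn Z
  rw [Pn_explicit x n _ u hu, ← Finset.sum_filter]
  simp only [mul_one]
  apply Finset.sum_le_sum_of_subset_of_nonneg
  · intro w hw
    rw [Finset.mem_filter] at hw
    rw [mem_Lwords]
    exact ⟨_, hw.2, fun k => by simp [app]⟩
  · intro w _ _
    exact Finset.prod_nonneg fun j _ => (hx _).le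

/-- follower candidates: `0^∞` (index 0) and tails of `b` -/
def cand (b : ℕ → Bool) (k : ℕ) : ℕ → Bool :=
  if k = 0 then fun _ => false else shiftTail b k

theorem zero_le (u : ℕ → Bool) : ¬ lexLt u (fun _ => false) := by
  rintro ⟨n, _, h⟩
  exact absurd (show u n < false from h) (by cases u n <;> decide)

theorem cand_mem {a b : ℕ → Bool} (hW : memW a b) (k : ℕ) : cand b k ∈ Omega a b := by
  unfold cand
  split_ifs
  · intro n h
    exact zero_le a h.1
  · exact Omega_shift hW.2.2.2 k

theorem exists_cand {a b : ℕ → Bool} (hW : memW a b) {n : ℕ} {w : Fin n → Bool}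
    (hw : w ∈ Lwords a b n) : ∃ k ∈ Finset.range (n + 1), app w (cand b k) ∈ Omega a b := by
  classical
  obtain ⟨i, hi, hiw⟩ := mem_Lwords.1 hw
  -- set of admissible candidates
  set F : Finset ℕ := (Finset.range (n + 1)).filter
    (fun k => k = 0 ∨ (∀ l < k, i (n - k + l) = b l)) with hF
  have hne : F.Nonempty := ⟨0, by simp [hF]⟩
  obtain ⟨k, hk, hmax⟩ := Finset.exists_max_image F (fun k => toLex (cand b k)) hne
  have hk' := Finset.mem_filter.1 hk
  refine ⟨k, hk'.1, ?_⟩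
  set v := cand b k with hv
  have happ : ∀ m, m < n → app w v m = i m := by
    intro m hm
    simp [app, hm, ← hiw ⟨m, hm⟩]
  have happ_tail : ∀ m, n ≤ m → shiftTail (app w v) m = shiftTail v (m - n) := by
    intro m hm
    funext l
    simp only [shiftTail, app]
    rw [dif_neg (by omega), show m + l - n = m - n + l by omega]
  -- v ≤ σ^n i
  have hvi : ¬ lexLt (shiftTail i n) v := by
    rw [hv]; unfold cand
    split_ifs with h0
    · exact zero_le _
    · have hm := hk'.2.resolve_left h0
      have hkn : k ≤ n := by have := Finset.mem_range.1 hk'.1; omega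
      have hti := Omega_shift hi (n - k)
      have h1 : ¬ lexLt (shiftTail i (n - k)) b := by
        apply ge_b hW.1 hti
        have := hm 0 (by omega)
        simp only [shiftTail]; rw [this]; exact hW.2.1
      rw [lexLt_shift (u := shiftTail i (n - k)) k (fun l hl => hm l hl), shift_shift, show n - k + k = n by omega] at h1
      exact h1
  intro m
  by_cases hmn : n ≤ m
  · rw [happ_tail m hmn]
    exact cand_mem hW k (m - n)
  push Not at hmn
  -- compare with the tail of i
  have hpre : ∀ l < n - m, shiftTail (app w v) m l = shiftTail i m l := fun l hl =>
    happ (m + l) (by omega)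
  have hle : ¬ lexLt (shiftTail i m) (shiftTail (app w v) m) := by
    rw [lexLt_shift (n - m) (fun l hl => (hpre l hl).symm), shift_shift, shift_shift,
      show m + (n - m) = n by omega, happ_tail n le_rfl, Nat.sub_self, shift_zero]
    exact hvi
  rintro ⟨h1, h2⟩
  have h3 : lexLt a (shiftTail i m) := lt_le_trans h1 hle
  have h4 : ¬ lexLt (shiftTail i m) b := fun h => hi m ⟨h3, h⟩
  -- prefix must match b
  have hmatch : ∀ l < n - m, shiftTail i m l = b l := by
    by_contra hc
    push Not at hc
    have hex : ∃ l, shiftTail i m l ≠ b l := ⟨hc.choose, hc.choose_spec.2⟩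
    set l := Nat.find hex with hl
    have hl1 : shiftTail i m l ≠ b l := Nat.find_spec hex
    have hl2 : ∀ j < l, shiftTail i m j = b j := fun j hj => by
      have := Nat.find_min hex hj
      simpa using this
    have hln : l < n - m := lt_of_le_of_lt (Nat.find_min' hex hc.choose_spec.2) hc.choose_spec.1
    have hbl : b l < shiftTail i m l := by
      rcases lt_or_gt_of_ne hl1 with h | h
      · exact absurd ⟨l, hl2, h⟩ h4
      · exact h
    refine lexLt_asymm h2 ⟨l, fun j hj => ?_, ?_⟩
    · rw [hpre j (by omega), hl2 j hj]
    · rw [hpre l hln]; exact hbl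
  have hmem : n - m ∈ F := by
    rw [hF, Finset.mem_filter]
    refine ⟨Finset.mem_range.2 (by omega), Or.inr fun l hl => ?_⟩
    rw [show n - (n - m) = m by omega]
    exact hmatch l hl
  have h5 := hmax _ hmem
  have h6 : ¬ lexLt v (cand b (n - m)) := by
    rw [lexLt_iff]; exact not_lt.2 h5
  rw [lexLt_shift (n - m) (fun l hl => (hpre l hl).trans (hmatch l hl)), shift_shift,
    show m + (n - m) = n by omega, happ_tail n le_rfl, Nat.sub_self, shift_zero] at h2
  apply h6
  unfold cand
  rw [if_neg (by omega)]
  exact h2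

theorem Z_le {a b : ℕ → Bool} (hW : memW a b) {x : Bool → ℝ} (hx : ∀ d, 0 < x d) (n : ℕ) :
    Z a b x n ≤ ∑ k ∈ Finset.range (n + 1), pn (Omega a b) x n (cand b k) := by
  classical
  unfold Z pn
  have : ∀ k ∈ Finset.range (n + 1), (P (Omega a b) x ^ n) (fun _ => 1) (cand b k)
      = ∑ w : Fin n → Bool, if app w (cand b k) ∈ Omega a b then (∏ j, x (w j)) else 0 := by
    intro k _
    rw [Pn_explicit x n _ _ (cand_mem hW k)]
    simp
  rw [Finset.sum_congr rfl this, Finset.sum_comm]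
  have hpos : ∀ w : Fin n → Bool, 0 ≤ ∏ j, x (w j) := fun w =>
    Finset.prod_nonneg fun j _ => (hx _).le
  have hterm : ∀ w : Fin n → Bool, ∀ k,
      0 ≤ if app w (cand b k) ∈ Omega a b then (∏ j, x (w j)) else 0 := by
    intro w k; split_ifs
    · exact hpos w
    · exact le_rfl
  calc ∑ w ∈ Lwords a b n, ∏ j, x (w j) ≤ ∑ w ∈ Lwords a b n, ∑ k ∈ Finset.range (n + 1),
        if app w (cand b k) ∈ Omega a b then (∏ j, x (w j)) else 0 := by
        apply Finset.sum_le_sum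
        intro w hw
        obtain ⟨k, hk, hk'⟩ := exists_cand hW hw
        have := Finset.single_le_sum (fun k _ => hterm w k) hk
        rwa [if_pos hk'] at this
    _ ≤ _ := Finset.sum_le_sum_of_subset_of_nonneg (Finset.subset_univ _)
        (fun w _ _ => Finset.sum_nonneg fun k _ => hterm w k)

theorem Z_pos {a b : ℕ → Bool} (hW : memW a b) {x : Bool → ℝ} (hx : ∀ d, 0 < x d) (n : ℕ) :
    0 < Z a b x n := by
  apply Finset.sum_pos
  · intro w _
    exact Finset.prod_pos fun j _ => hx _
  · exact ⟨fun k => a k.1, mem_Lwords.2 ⟨a, hW.2.2.1, fun _ => rfl⟩⟩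

/-- weight of a prefix -/
noncomputable def X (x : Bool → ℝ) (v : ℕ → Bool) (k : ℕ) : ℝ := ∏ j ∈ Finset.range k, x (v j)

/-- digit as a real number -/
noncomputable def dg (d : Bool) : ℝ := if d then 1 else 0

theorem X_succ (x : Bool → ℝ) (v : ℕ → Bool) (k : ℕ) : X x v (k + 1) = X x v k * x (v k) :=
  Finset.prod_range_succ _ _

theorem X_nonneg {x : Bool → ℝ} (hx : ∀ d, 0 < x d) (v : ℕ → Bool) (k : ℕ) : 0 ≤ X x v k :=
  Finset.prod_nonneg fun _ _ => (hx _).le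

theorem X_le {x : Bool → ℝ} (hx : ∀ d, 0 < x d) {ρ : ℝ} (hρ : ∀ d, x d ≤ ρ) (v : ℕ → Bool)
    (k : ℕ) : X x v k ≤ ρ ^ k := by
  have := Finset.prod_le_prod (s := Finset.range k) (fun j _ => (hx (v j)).le)
    (fun j _ => hρ (v j))
  simpa [X] using this

open Classical in
/-- indicator of `u ≤ v` -/
noncomputable def eL (v u : ℕ → Bool) : ℝ := if lexLt v u then 0 else 1

open Classical in
/-- indicator of `v ≤ u` -/
noncomputable def eR (v u : ℕ → Bool) : ℝ := if lexLt u v then 0 else 1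

theorem eL_mem (v u : ℕ → Bool) : 0 ≤ eL v u ∧ eL v u ≤ 1 := by
  unfold eL; split_ifs <;> norm_num

theorem eR_mem (v u : ℕ → Bool) : 0 ≤ eR v u ∧ eR v u ≤ 1 := by
  unfold eR; split_ifs <;> norm_num

theorem dg_mem (d : Bool) : 0 ≤ dg d ∧ dg d ≤ 1 := by
  unfold dg; split_ifs <;> norm_num

/-- left part of the eigenfunction -/
noncomputable def hA (x : Bool → ℝ) (a u : ℕ → Bool) : ℝ :=
  ∑' k, X x a k * (eL (shiftTail a k) u - dg (a k))

/-- right part of the eigenfunction -/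
noncomputable def hB (x : Bool → ℝ) (b u : ℕ → Bool) : ℝ :=
  ∑' k, X x b k * (eR (shiftTail b k) u - (1 - dg (b k)))

section
variable {x : Bool → ℝ} {ρ : ℝ}

theorem X_summable (hx : ∀ d, 0 < x d) (hρ : ∀ d, x d ≤ ρ) (hρ1 : ρ < 1) (v : ℕ → Bool)
    (c : ℕ → ℝ) (hc : ∀ k, |c k| ≤ 1) : Summable (fun k => X x v k * c k) := by
  have hρ0 : 0 ≤ ρ := (hx true).le.trans (hρ true)
  refine Summable.of_norm_bounded (summable_geometric_of_lt_one hρ0 hρ1) fun k => ?_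
  rw [Real.norm_eq_abs, abs_mul, abs_of_nonneg (X_nonneg hx v k)]
  calc X x v k * |c k| ≤ X x v k * 1 := mul_le_mul_of_nonneg_left (hc k) (X_nonneg hx v k)
    _ ≤ ρ ^ k := by rw [mul_one]; exact X_le hx hρ v k

theorem X_tsum_abs_le (hx : ∀ d, 0 < x d) (hρ : ∀ d, x d ≤ ρ) (hρ1 : ρ < 1) (v : ℕ → Bool)
    (c : ℕ → ℝ) (hc : ∀ k, |c k| ≤ 1) : |∑' k, X x v k * c k| ≤ (1 - ρ)⁻¹ := by
  have hρ0 : 0 ≤ ρ := (hx true).le.trans (hρ true)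
  refine tsum_of_norm_bounded (f := fun k => X x v k * c k)
    (hasSum_geometric_of_lt_one hρ0 hρ1) fun k => ?_
  rw [Real.norm_eq_abs, abs_mul, abs_of_nonneg (X_nonneg hx v k)]
  calc X x v k * |c k| ≤ X x v k * 1 := mul_le_mul_of_nonneg_left (hc k) (X_nonneg hx v k)
    _ ≤ ρ ^ k := by rw [mul_one]; exact X_le hx hρ v k

theorem hA_abs (hx : ∀ d, 0 < x d) (hρ : ∀ d, x d ≤ ρ) (hρ1 : ρ < 1) (a u : ℕ → Bool) :
    |hA x a u| ≤ (1 - ρ)⁻¹ := by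
  apply X_tsum_abs_le hx hρ hρ1
  intro k
  have h1 := eL_mem (shiftTail a k) u
  have h2 := dg_mem (a k)
  rw [abs_le]; constructor <;> linarith

theorem hB_abs (hx : ∀ d, 0 < x d) (hρ : ∀ d, x d ≤ ρ) (hρ1 : ρ < 1) (a u : ℕ → Bool) :
    |hB x a u| ≤ (1 - ρ)⁻¹ := by
  apply X_tsum_abs_le hx hρ hρ1
  intro k
  have h1 := eR_mem (shiftTail a k) u
  have h2 := dg_mem (a k)
  rw [abs_le]; constructor <;> linarith

theorem A_summable (hx : ∀ d, 0 < x d) (hρ : ∀ d, x d ≤ ρ) (hρ1 : ρ < 1) (a u : ℕ → Bool) :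
    Summable (fun k => X x a k * (eL (shiftTail a k) u - dg (a k))) := by
  apply X_summable hx hρ hρ1
  intro k
  have h1 := eL_mem (shiftTail a k) u
  have h2 := dg_mem (a k)
  rw [abs_le]; constructor <;> linarith

theorem B_summable (hx : ∀ d, 0 < x d) (hρ : ∀ d, x d ≤ ρ) (hρ1 : ρ < 1) (a u : ℕ → Bool) :
    Summable (fun k => X x a k * (eR (shiftTail a k) u - (1 - dg (a k)))) := by
  apply X_summable hx hρ hρ1
  intro k
  have h1 := eR_mem (shiftTail a k) u
  have h2 := dg_mem (a k)
  rw [abs_le]; constructor <;> linarith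

theorem tele (hx : ∀ d, 0 < x d) (hρ : ∀ d, x d ≤ ρ) (hρ1 : ρ < 1) (v : ℕ → Bool)
    (c : ℕ → ℝ) (hc : ∀ k, |c k| ≤ 1) :
    ∑' k, X x v k * c k - ∑' k, X x v (k + 1) * c (k + 1) = c 0 := by
  rw [(X_summable hx hρ hρ1 v c hc).tsum_eq_zero_add]
  simp [X]

/-- the value of the expansion, in terms of weights -/
noncomputable def pv (x : Bool → ℝ) (v : ℕ → Bool) : ℝ := ∑' k, X x v k * dg (v k)

theorem mem_alpha {a b u v : ℕ → Bool} (hW : memW a b) (hu : u ∈ Omega a b)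
    (hv : v ∈ Omega a b) (h0 : v 0 = false) (h : ¬ lexLt (shiftTail v 1) u) :
    consS false u ∈ Omega a b := by
  rw [cons_false_mem hW.2.1 hu]
  intro h'
  have h1 := le_a hW.2.1 hv h0
  have h2 : lexLt v (consS false u) := le_lt_trans h1 h'
  rw [← consS_shift v, h0, lexLt_cons] at h2
  exact h h2

theorem mem_beta {a b u v : ℕ → Bool} (hW : memW a b) (hu : u ∈ Omega a b)
    (hv : v ∈ Omega a b) (h0 : v 0 = true) (h : ¬ lexLt u (shiftTail v 1)) :
    consS true u ∈ Omega a b := by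
  rw [cons_true_mem hW.1 hu]
  intro h'
  have h1 := ge_b hW.1 hv h0
  have h2 : lexLt (consS true u) v := lt_le_trans h' h1
  rw [← consS_shift v, h0, lexLt_cons] at h2
  exact h h2

theorem eL_cons (d : Bool) (v u : ℕ → Bool) (h0 : v 0 = d) :
    eL v (consS d u) = eL (shiftTail v 1) u := by
  unfold eL
  have : lexLt v (consS d u) ↔ lexLt (shiftTail v 1) u := by
    conv_lhs => rw [← consS_shift v, h0]
    exact lexLt_cons _ _ _
  by_cases h : lexLt (shiftTail v 1) u
  · rw [if_pos (this.2 h), if_pos h]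
  · rw [if_neg (mt this.1 h), if_neg h]

theorem eR_cons (d : Bool) (v u : ℕ → Bool) (h0 : v 0 = d) :
    eR v (consS d u) = eR (shiftTail v 1) u := by
  unfold eR
  have : lexLt (consS d u) v ↔ lexLt u (shiftTail v 1) := by
    conv_lhs => rw [← consS_shift v, h0]
    exact lexLt_cons _ _ _
  by_cases h : lexLt u (shiftTail v 1)
  · rw [if_pos (this.2 h), if_pos h]
  · rw [if_neg (mt this.1 h), if_neg h]

open Classical in
theorem termA {a b u v : ℕ → Bool} (hW : memW a b) (hu : u ∈ Omega a b)
    (hv : v ∈ Omega a b) :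
    (if consS false u ∈ Omega a b then x false * (eL v (consS false u) - dg (v 0)) else 0)
    + (if consS true u ∈ Omega a b then x true * (eL v (consS true u) - dg (v 0)) else 0)
    = x (v 0) * eL (shiftTail v 1) u - x true * dg (v 0) := by
  cases h0 : v 0 with
  | false =>
    rw [eL_cons false v u h0]
    have h1 : eL v (consS true u) = 0 := by
      unfold eL; rw [if_pos (lexLt_of_zero h0 rfl)]
    rw [h1]
    by_cases h : lexLt (shiftTail v 1) u
    · have : eL (shiftTail v 1) u = 0 := by unfold eL; rw [if_pos h]
      rw [this]; simp [dg]
    · rw [if_pos (mem_alpha hW hu hv h0 h)]; simp [dg]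
  | true =>
    rw [eL_cons true v u h0]
    have h1 : eL v (consS false u) = 1 := by
      unfold eL; rw [if_neg (lexLt_asymm (lexLt_of_zero rfl h0))]
    rw [h1]
    by_cases h : lexLt u (shiftTail v 1)
    · have : eL (shiftTail v 1) u = 1 := by unfold eL; rw [if_neg (lexLt_asymm h)]
      rw [this]; simp [dg]
    · rw [if_pos (mem_beta hW hu hv h0 h)]; simp [dg]; ring

open Classical in
theorem termB {a b u v : ℕ → Bool} (hW : memW a b) (hu : u ∈ Omega a b)
    (hv : v ∈ Omega a b) :
    (if consS false u ∈ Omega a b then x false * (eR v (consS false u) - (1 - dg (v 0))) else 0)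
    + (if consS true u ∈ Omega a b then x true * (eR v (consS true u) - (1 - dg (v 0))) else 0)
    = x (v 0) * eR (shiftTail v 1) u - x false * (1 - dg (v 0)) := by
  cases h0 : v 0 with
  | true =>
    rw [eR_cons true v u h0]
    have h1 : eR v (consS false u) = 0 := by
      unfold eR; rw [if_pos (lexLt_of_zero rfl h0)]
    rw [h1]
    by_cases h : lexLt u (shiftTail v 1)
    · have : eR (shiftTail v 1) u = 0 := by unfold eR; rw [if_pos h]
      rw [this]; simp [dg]
    · rw [if_pos (mem_beta hW hu hv h0 h)]; simp [dg]
  | false =>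
    rw [eR_cons false v u h0]
    have h1 : eR v (consS true u) = 1 := by
      unfold eR; rw [if_neg (lexLt_asymm (lexLt_of_zero h0 rfl))]
    rw [h1]
    by_cases h : lexLt (shiftTail v 1) u
    · have : eR (shiftTail v 1) u = 1 := by unfold eR; rw [if_neg (lexLt_asymm h)]
      rw [this]; simp [dg]
    · rw [if_pos (mem_alpha hW hu hv h0 h)]; simp [dg]; ring

theorem P_tsum {Om : Set (ℕ → Bool)} (F : ℕ → (ℕ → Bool) → ℝ) (hF : ∀ u, Summable fun k => F k u)
    (u : ℕ → Bool) : P Om x (fun v => ∑' k, F k v) u = ∑' k, P Om x (F k) u := by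
  classical
  simp only [P_apply]
  rw [Summable.tsum_add]
  · congr 1 <;> split_ifs <;> simp [tsum_mul_left]
  · split_ifs
    · exact (hF _).mul_left _
    · exact summable_zero
  · split_ifs
    · exact (hF _).mul_left _
    · exact summable_zero

theorem shift_apply_zero (v : ℕ → Bool) (k : ℕ) : shiftTail v k 0 = v k := rfl

theorem idA {a b u : ℕ → Bool} (hx : ∀ d, 0 < x d) (hρ : ∀ d, x d ≤ ρ) (hρ1 : ρ < 1)
    (hW : memW a b) (hu : u ∈ Omega a b) :
    hA x a u - P (Omega a b) x (hA x a) u = eL a u - (1 - x true) * pv x a := by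
  classical
  have h1 : P (Omega a b) x (hA x a) u
      = ∑' k, (X x a (k + 1) * eL (shiftTail a (k + 1)) u - x true * (X x a k * dg (a k))) := by
    have := P_tsum (x := x) (Om := Omega a b)
      (fun k v => X x a k * (eL (shiftTail a k) v - dg (a k)))
      (fun v => A_summable hx hρ hρ1 a v) u
    refine this.trans (tsum_congr fun k => ?_)
    have ht := termA (x := x) hW hu (Omega_shift hW.2.2.1 k)
    rw [shift_shift, shift_apply_zero] at ht
    rw [P_apply, X_succ, mul_assoc, mul_left_comm (x true) (X x a k) (dg (a k)), ← mul_sub, ← ht]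
    split_ifs <;> ring
  have hcE : ∀ k, |eL (shiftTail a k) u| ≤ 1 := fun k => by
    rw [abs_of_nonneg (eL_mem _ _).1]; exact (eL_mem _ _).2
  have hcD : ∀ k, |dg (a k)| ≤ 1 := fun k => by
    rw [abs_of_nonneg (dg_mem _).1]; exact (dg_mem _).2
  have sE := X_summable hx hρ hρ1 a _ hcE
  have sD := X_summable hx hρ hρ1 a _ hcD
  have sE' : Summable fun k => X x a (k + 1) * eL (shiftTail a (k + 1)) u :=
    (summable_nat_add_iff 1).2 sE
  rw [h1, Summable.tsum_sub sE' (sD.mul_left _), tsum_mul_left]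
  have h2 : hA x a u = ∑' k, X x a k * eL (shiftTail a k) u - pv x a := by
    unfold hA pv
    rw [← Summable.tsum_sub sE sD]
    exact tsum_congr fun k => by ring
  have h3 := tele hx hρ hρ1 a _ hcE
  rw [shift_zero] at h3
  rw [h2]
  change _ - (_ - x true * pv x a) = _
  linarith

theorem idB {a b u : ℕ → Bool} (hx : ∀ d, 0 < x d) (hρ : ∀ d, x d ≤ ρ) (hρ1 : ρ < 1)
    (hW : memW a b) (hu : u ∈ Omega a b) :
    hB x b u - P (Omega a b) x (hB x b) u
      = eR b u - (1 - x false) * ∑' k, X x b k * (1 - dg (b k)) := by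
  classical
  have h1 : P (Omega a b) x (hB x b) u
      = ∑' k, (X x b (k + 1) * eR (shiftTail b (k + 1)) u
        - x false * (X x b k * (1 - dg (b k)))) := by
    have := P_tsum (x := x) (Om := Omega a b)
      (fun k v => X x b k * (eR (shiftTail b k) v - (1 - dg (b k))))
      (fun v => B_summable hx hρ hρ1 b v) u
    refine this.trans (tsum_congr fun k => ?_)
    have ht := termB (x := x) hW hu (Omega_shift hW.2.2.2 k)
    rw [shift_shift, shift_apply_zero] at ht
    rw [P_apply, X_succ, mul_assoc, mul_left_comm (x false) (X x b k) (1 - dg (b k)), ← mul_sub, ← ht]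
    split_ifs <;> ring
  have hcE : ∀ k, |eR (shiftTail b k) u| ≤ 1 := fun k => by
    rw [abs_of_nonneg (eR_mem _ _).1]; exact (eR_mem _ _).2
  have hcD : ∀ k, |1 - dg (b k)| ≤ 1 := fun k => by
    have := dg_mem (b k)
    rw [abs_le]; constructor <;> linarith
  have sE := X_summable hx hρ hρ1 b _ hcE
  have sD := X_summable hx hρ hρ1 b _ hcD
  have sE' : Summable fun k => X x b (k + 1) * eR (shiftTail b (k + 1)) u :=
    (summable_nat_add_iff 1).2 sE
  rw [h1, Summable.tsum_sub sE' (sD.mul_left _), tsum_mul_left]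
  have h2 : hB x b u = ∑' k, X x b k * eR (shiftTail b k) u
      - ∑' k, X x b k * (1 - dg (b k)) := by
    unfold hB
    rw [← Summable.tsum_sub sE sD]
    exact tsum_congr fun k => by ring
  have h3 := tele hx hρ hρ1 b _ hcE
  rw [shift_zero] at h3
  rw [h2]
  linarith

theorem gamma_id (hx : ∀ d, 0 < x d) (hρ : ∀ d, x d ≤ ρ) (hρ1 : ρ < 1) (v : ℕ → Bool) :
    (1 - x false) * ∑' k, X x v k * (1 - dg (v k)) = 1 - (1 - x true) * pv x v := by
  have hcD : ∀ k, |dg (v k)| ≤ 1 := fun k => by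
    rw [abs_of_nonneg (dg_mem _).1]; exact (dg_mem _).2
  have hcD' : ∀ k, |1 - dg (v k)| ≤ 1 := fun k => by
    have := dg_mem (v k)
    rw [abs_le]; constructor <;> linarith
  have sD := X_summable hx hρ hρ1 v _ hcD
  have sD' := X_summable hx hρ hρ1 v _ hcD'
  have s1 := X_summable hx hρ hρ1 v (fun _ => 1) (fun _ => by simp)
  have s1' : Summable fun k => X x v (k + 1) * 1 := (summable_nat_add_iff 1).2 s1
  have h := tele hx hρ hρ1 v (fun _ => 1) (fun _ => by simp)
  rw [← Summable.tsum_sub s1 s1'] at h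
  refine Eq.trans ?_ (congrArg (fun y => y - (1 - x true) * pv x v) h)
  rw [pv, ← tsum_mul_left, ← tsum_mul_left, ← Summable.tsum_sub _ (sD.mul_left _)]
  · refine tsum_congr fun k => ?_
    rw [X_succ]
    cases v k <;> simp [dg] <;> ring
  · exact (s1.sub s1')

/-- the full function -/
noncomputable def hh (x : Bool → ℝ) (a b u : ℕ → Bool) : ℝ := hA x a u + hB x b u

theorem hh_id {a b u : ℕ → Bool} (hx : ∀ d, 0 < x d) (hρ : ∀ d, x d ≤ ρ) (hρ1 : ρ < 1)
    (hW : memW a b) (hu : u ∈ Omega a b) :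
    hh x a b u - P (Omega a b) x (hh x a b) u = (1 - x true) * (pv x b - pv x a) := by
  have h1 := idA hx hρ hρ1 hW hu
  have h2 := idB hx hρ hρ1 hW hu
  rw [gamma_id hx hρ hρ1] at h2
  have h3 : P (Omega a b) x (hh x a b) u
      = P (Omega a b) x (hA x a) u + P (Omega a b) x (hB x b) u := by
    rw [show hh x a b = hA x a + hB x b from rfl, map_add, Pi.add_apply]
  have h4 : eL a u + eR b u = 1 := by
    unfold eL eR
    cases h0 : u 0 with
    | false =>
      rw [if_neg (le_a hW.2.1 hu h0), if_pos (lexLt_of_zero h0 hW.2.1)]; simp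
    | true =>
      rw [if_neg (ge_b hW.1 hu h0), if_pos (lexLt_of_zero hW.1 h0)]; simp
  rw [h3, hh]
  linarith

theorem hh_abs {a b : ℕ → Bool} (hx : ∀ d, 0 < x d) (hρ : ∀ d, x d ≤ ρ) (hρ1 : ρ < 1)
    (u : ℕ → Bool) : |hh x a b u| ≤ 2 * (1 - ρ)⁻¹ := by
  have h1 := hA_abs hx hρ hρ1 a u
  have h2 := hB_abs hx hρ hρ1 b u
  have := abs_add_le (hA x a u) (hB x b u)
  unfold hh
  linarith

theorem hh_a {a b : ℕ → Bool} (hx : ∀ d, 0 < x d) (hρ : ∀ d, x d ≤ ρ) (hρ1 : ρ < 1)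
    (hW : memW a b) : 1 ≤ hh x a b a := by
  have h1 : 1 ≤ hA x a a := by
    have hnn : ∀ k, 0 ≤ X x a k * (eL (shiftTail a k) a - dg (a k)) := by
      intro k
      apply mul_nonneg (X_nonneg hx a k)
      cases h : a k with
      | false => simpa [dg] using (eL_mem _ _).1
      | true =>
        have : eL (shiftTail a k) a = 1 := by
          unfold eL
          rw [if_neg (lexLt_asymm (lexLt_of_zero hW.1 h))]
        rw [this]; simp [dg]
    have := (A_summable hx hρ hρ1 a a).le_tsum 0 (fun k _ => hnn k)
    refine le_trans (le_of_eq ?_) this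
    rw [shift_zero, hW.1]
    simp [X, eL, dg, lexLt_irrefl]
  have h2 : 0 ≤ hB x b a := by
    apply tsum_nonneg
    intro k
    apply mul_nonneg (X_nonneg hx b k)
    cases h : b k with
    | true => simpa [dg] using (eR_mem _ _).1
    | false =>
      have : eR (shiftTail b k) a = 1 := by
        unfold eR
        rw [if_neg (le_a hW.2.1 (Omega_shift hW.2.2.2 k) h)]
      rw [this]; simp [dg]
  unfold hh; linarith

/-- no root when partition sums tend to zero -/
theorem no_root {a b : ℕ → Bool} (hx : ∀ d, 0 < x d) (hρ : ∀ d, x d ≤ ρ) (hρ1 : ρ < 1)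
    (hW : memW a b) (hZ : Tendsto (fun n => Z a b x n) atTop (𝓝 0)) : pv x a ≠ pv x b := by
  intro h
  have hid : ∀ n, hh x a b a ≤ 2 * (1 - ρ)⁻¹ * Z a b x n := by
    intro n
    have h1 := iterate_id hx (fun u hu => hh_id hx hρ hρ1 hW hu) n a hW.2.2.1
    rw [h, sub_self, mul_zero, zero_mul, add_zero] at h1
    have h2 := Pn_abs_le (Om := Omega a b) hx n (fun u _ => hh_abs (a := a) (b := b) hx hρ hρ1 u)
      a hW.2.2.1
    have h3 := pn_le_Z hx n a hW.2.2.1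
    have hρ' : 0 ≤ 2 * (1 - ρ)⁻¹ := by
      have : 0 < 1 - ρ := by linarith
      positivity
    rw [h1]
    exact (le_abs_self _).trans (h2.trans (mul_le_mul_of_nonneg_left h3 hρ'))
  have h4 : Tendsto (fun n => 2 * (1 - ρ)⁻¹ * Z a b x n) atTop (𝓝 0) := by
    simpa using hZ.const_mul (2 * (1 - ρ)⁻¹)
  have h5 := ge_of_tendsto' h4 hid
  have h6 := hh_a hx hρ hρ1 hW
  linarith

/-- root when partition sums are subexponential in both directions -/
theorem root {a b : ℕ → Bool} (hx : ∀ d, 0 < x d) (hρ : ∀ d, x d ≤ ρ) (hρ1 : ρ < 1)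
    (hW : memW a b)
    (hZ1 : ∀ r : ℝ, 1 < r → ∀ᶠ n in atTop, Z a b x n ≤ r ^ n)
    (hZ2 : ∀ r : ℝ, 0 < r → r < 1 → ∀ᶠ n in atTop, r ^ n ≤ Z a b x n) :
    pv x a = pv x b := by
  by_contra hne
  set δ := (1 - x true) * (pv x b - pv x a) with hδ
  have hδ0 : δ ≠ 0 := by
    apply mul_ne_zero
    · have := hρ true; linarith
    · intro h; apply hne; linarith
  have hδp : 0 < |δ| := abs_pos.2 hδ0
  set K := 2 * (1 - ρ)⁻¹ with hK
  have hK0 : 0 < K := by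
    have : 0 < 1 - ρ := by linarith
    positivity
  set C := K / |δ| with hC
  have hC0 : 0 < C := by positivity
  have main : ∀ u ∈ Omega a b, ∀ n,
      ∑ k ∈ Finset.range n, pn (Omega a b) x k u ≤ C * (1 + pn (Omega a b) x n u) := by
    intro u hu n
    have h1 := iterate_id hx (fun u hu => hh_id hx hρ hρ1 hW hu) n u hu
    rw [← hδ] at h1
    have h2 := Pn_abs_le (Om := Omega a b) hx n (fun u _ => hh_abs (a := a) (b := b) hx hρ hρ1 u)
      u hu
    have h3 := hh_abs (a := a) (b := b) hx hρ hρ1 u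
    rw [← hK] at h2 h3
    set S := ∑ k ∈ Finset.range n, pn (Omega a b) x k u with hS
    have hS0 : 0 ≤ S := Finset.sum_nonneg fun k _ => pn_nonneg hx k u hu
    have h4 : |δ| * S ≤ K + K * pn (Omega a b) x n u := by
      rw [← abs_of_nonneg hS0, ← abs_mul,
        show δ * S = hh x a b u - (P (Omega a b) x ^ n) (hh x a b) u by linarith]
      exact (abs_sub _ _).trans (add_le_add h3 h2)
    rw [hC, div_mul_eq_mul_div, le_div_iff₀ hδp]
    linarith
  -- bounded Green function
  have hS : ∀ u ∈ Omega a b, ∀ n, ∑ k ∈ Finset.range n, pn (Omega a b) x k u ≤ C := by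
    intro u hu m
    by_contra hc
    push Not at hc
    set S : ℕ → ℝ := fun n => ∑ k ∈ Finset.range n, pn (Omega a b) x k u with hSdef
    set r := 1 + 1 / C with hr
    have hr1 : 1 < r := by rw [hr]; have : 0 < 1 / C := by positivity
                           linarith
    have hp : ∀ n, (S n - C) / C ≤ pn (Omega a b) x n u := by
      intro n
      rw [div_le_iff₀ hC0]
      have := main u hu n
      change S n ≤ _ at this
      linarith
    have grow : ∀ j, r ^ j * (S m - C) ≤ S (m + j) - C := by
      intro j
      induction j with
      | zero => simp
      | succ j ih =>
        have e : S (m + (j + 1)) = S (m + j) + pn (Omega a b) x (m + j) u := by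
          rw [← add_assoc]; exact Finset.sum_range_succ _ _
        have h1 := hp (m + j)
        have h2 : r * (S (m + j) - C) = (S (m + j) - C) + (S (m + j) - C) / C := by
          rw [hr]; ring
        have h3 : r * (r ^ j * (S m - C)) ≤ r * (S (m + j) - C) :=
          mul_le_mul_of_nonneg_left ih (by linarith)
        rw [e, pow_succ]
        linarith
    set c := (S m - C) / C with hcdef
    have hc0 : 0 < c := div_pos (by change C < S m at hc; linarith) hC0
    obtain ⟨r', hr'1, hr'2⟩ := exists_between hr1
    have ev := (tendsto_add_atTop_nat m).eventually (hZ1 r' hr'1)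
    have hle : ∀ᶠ j in atTop, c ≤ r' ^ m * (r' / r) ^ j := by
      filter_upwards [ev] with j hj
      have h1 := pn_le_Z hx (j + m) u hu
      have h2 := hp (j + m)
      have h3 := grow j
      rw [add_comm m j] at h3
      have h4 : r ^ j * c ≤ (S (j + m) - C) / C := by
        rw [hcdef, ← mul_div_assoc]
        exact div_le_div_of_nonneg_right h3 hC0.le
      have h5 : r ^ j * c ≤ r' ^ (j + m) := by linarith
      have hrj : 0 < r ^ j := by have : 0 < r := by linarith
                                 positivity
      rw [div_pow, mul_div_assoc', le_div_iff₀ hrj]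
      rw [pow_add] at h5
      linarith
    have ht : Tendsto (fun j : ℕ => r' ^ m * (r' / r) ^ j) atTop (𝓝 (r' ^ m * 0)) :=
      (tendsto_pow_atTop_nhds_zero_of_lt_one (by apply div_nonneg <;> linarith)
        (by rw [div_lt_one (by linarith)]; exact hr'2)).const_mul _
    have := ge_of_tendsto ht hle
    linarith
  have hC1 : 1 ≤ C := by
    have := hS a hW.2.2.1 1
    simpa [pn] using this
  set θ := 1 - 1 / C with hθ
  have hθ0 : 0 ≤ θ := by rw [hθ, sub_nonneg, div_le_one hC0]; exact hC1
  have hθ1 : θ < 1 := by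
    have : 0 < 1 / C := by positivity
    rw [hθ]; linarith
  have hZb : ∀ n : ℕ, Z a b x n ≤ (n + 1) * (C * θ ^ n) := by
    intro n
    refine (Z_le hW hx n).trans ?_
    have := Finset.sum_le_card_nsmul (Finset.range (n + 1))
      (fun k => pn (Omega a b) x n (cand b k)) (C * θ ^ n)
      (fun k _ => decay hx hC1 hS n _ (cand_mem hW k))
    simpa using this
  obtain ⟨r, hr1, hr2⟩ := exists_between hθ1
  have hr0 : 0 < r := by linarith
  have hle : ∀ᶠ n : ℕ in atTop, (1 : ℝ) ≤ C * ((n : ℝ) * (θ / r) ^ n) + C * (θ / r) ^ n := by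
    filter_upwards [hZ2 r hr0 hr2] with n hn
    have h1 := hn.trans (hZb n)
    have hrn : 0 < r ^ n := by positivity
    have : C * ((n : ℝ) * (θ / r) ^ n) + C * (θ / r) ^ n = ((n + 1) * (C * θ ^ n)) / r ^ n := by
      rw [div_pow]; ring
    rw [this, le_div_iff₀ hrn]
    linarith
  have hq0 : 0 ≤ θ / r := by positivity
  have hq1 : θ / r < 1 := by rw [div_lt_one hr0]; exact hr1
  have ht : Tendsto (fun n : ℕ => C * ((n : ℝ) * (θ / r) ^ n) + C * (θ / r) ^ n) atTop
      (𝓝 (C * 0 + C * 0)) :=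
    ((tendsto_self_mul_const_pow_of_lt_one hq0 hq1).const_mul C).add
      ((tendsto_pow_atTop_nhds_zero_of_lt_one hq0 hq1).const_mul C)
  have := ge_of_tendsto ht hle
  norm_num at this

end

/-- weights for the exponent `t` -/
noncomputable def wt (q0 q1 t : ℝ) (d : Bool) : ℝ := (qb q0 q1 d) ^ (-t)

theorem qb_gt {q0 q1 : ℝ} (hq0 : 1 < q0) (hq1 : 1 < q1)
    (d : Bool) : 1 < qb q0 q1 d := by
  cases d <;> simpa [qb]

theorem wt_pos {q0 q1 : ℝ} (hq0 : 1 < q0) (hq1 : 1 < q1)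
    (t : ℝ) (d : Bool) : 0 < wt q0 q1 t d :=
  Real.rpow_pos_of_pos (by have := qb_gt hq0 hq1 d; linarith) _

theorem wt_lt {q0 q1 : ℝ} (hq0 : 1 < q0) (hq1 : 1 < q1)
    (t : ℝ) (ht : 0 < t) (d : Bool) : wt q0 q1 t d < 1 :=
  Real.rpow_lt_one_of_one_lt_of_neg (qb_gt hq0 hq1 d) (by linarith)

theorem wt_bound {q0 q1 : ℝ} (hq0 : 1 < q0) (hq1 : 1 < q1)
    (t : ℝ) (ht : 0 < t) :
    ∃ ρ < 1, ∀ d, wt q0 q1 t d ≤ ρ := by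
  refine ⟨max (wt q0 q1 t false) (wt q0 q1 t true),
    max_lt (wt_lt hq0 hq1 t ht _) (wt_lt hq0 hq1 t ht _), fun d => ?_⟩
  cases d
  · exact le_max_left _ _
  · exact le_max_right _ _

theorem piE_eq {q0 q1 : ℝ} (hq0 : 1 < q0) (hq1 : 1 < q1)
    (t : ℝ) (v : ℕ → Bool) :
    piE (q0 ^ t) (q1 ^ t) v = wt q0 q1 t true * pv (wt q0 q1 t) v := by
  unfold piE pv
  rw [← tsum_mul_left]
  refine tsum_congr fun k => ?_
  have h1 : ∀ d, qb (q0 ^ t) (q1 ^ t) d = (wt q0 q1 t d)⁻¹ := by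
    intro d
    unfold wt
    rw [Real.rpow_neg (by have := qb_gt hq0 hq1 d; linarith), inv_inv]
    cases d <;> simp [qb]
  simp only [h1]
  rw [Finset.prod_inv_distrib, div_inv_eq_mul]
  change _ * X _ v (k + 1) = _
  rw [X_succ]
  cases v k <;> simp [dg]; ring

theorem Z_eq {q0 q1 : ℝ} (hq0 : 1 < q0) (hq1 : 1 < q1)
    (a b : ℕ → Bool) (t : ℝ) (n : ℕ) :
    ∑ w ∈ Lwords a b n, (∏ j : Fin n, qb q0 q1 (w j)) ^ (-t) = Z a b (wt q0 q1 t) n := by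
  refine Finset.sum_congr rfl fun w _ => ?_
  unfold wt
  rw [Real.finsetProd_rpow]
  intro j _
  have := qb_gt hq0 hq1 (w j)
  linarith

theorem Z_shift {q0 q1 : ℝ} (hq0 : 1 < q0) (hq1 : 1 < q1)
    (a b : ℕ → Bool) (s t ρ : ℝ) (hρ : ∀ d, wt q0 q1 (t - s) d ≤ ρ) (n : ℕ) :
    Z a b (wt q0 q1 t) n ≤ ρ ^ n * Z a b (wt q0 q1 s) n := by
  unfold Z
  rw [Finset.mul_sum]
  refine Finset.sum_le_sum fun w _ => ?_
  have h1 : ∀ d, wt q0 q1 t d = wt q0 q1 (t - s) d * wt q0 q1 s d := by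
    intro d
    unfold wt
    rw [← Real.rpow_add (by have := qb_gt hq0 hq1 d; linarith)]
    congr 1; ring
  simp only [h1]
  rw [Finset.prod_mul_distrib]
  apply mul_le_mul_of_nonneg_right
  · have := Finset.prod_le_prod (s := Finset.univ) (fun (j : Fin n) _ =>
      (wt_pos hq0 hq1 (t - s) (w j)).le) (fun j _ => hρ (w j))
    simpa using this
  · exact Finset.prod_nonneg fun j _ => (wt_pos hq0 hq1 _ _).le

theorem log_upper {z : ℕ → ℝ} (hz : ∀ n, 0 < z n)
    (hl : Tendsto (fun n : ℕ => Real.log (z n) / n) atTop (𝓝 0)) (r : ℝ) (hr : 1 < r) :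
    ∀ᶠ n in atTop, z n ≤ r ^ n := by
  filter_upwards [hl.eventually_lt_const (Real.log_pos hr), eventually_gt_atTop 0] with n h1 hn
  have hn' : (0 : ℝ) < n := by exact_mod_cast hn
  rw [div_lt_iff₀ hn'] at h1
  rw [← Real.log_le_log_iff (hz n) (by positivity), Real.log_pow]
  linarith

theorem log_lower {z : ℕ → ℝ} (hz : ∀ n, 0 < z n)
    (hl : Tendsto (fun n : ℕ => Real.log (z n) / n) atTop (𝓝 0)) (r : ℝ) (hr0 : 0 < r)
    (hr : r < 1) : ∀ᶠ n in atTop, r ^ n ≤ z n := by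
  filter_upwards [hl.eventually_const_lt (Real.log_neg hr0 hr), eventually_gt_atTop 0] with n h1 hn
  have hn' : (0 : ℝ) < n := by exact_mod_cast hn
  rw [lt_div_iff₀ hn'] at h1
  rw [← Real.log_le_log_iff (by positivity) (hz n), Real.log_pow]
  linarith

end S12

/-- Lemma 2.2: if `(a,b) ∈ W`, `q₀,q₁ > 1`, and `s > 0` satisfies
`lim_{n→∞} (1/n) log Σ_{i₁⋯iₙ ∈ L_{a,b,n}} (q_{i₁}⋯q_{iₙ})^{−s} = 0`, then `s` is the
maximal root of `π_{q₀^s,q₁^s}(a) = π_{q₀^s,q₁^s}(b)`. -/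
theorem stmt12 (a b : ℕ → Bool) (q0 q1 s : ℝ) (hW : memW a b) (hq0 : 1 < q0) (hq1 : 1 < q1)
    (hs : 0 < s)
    (hlim : Filter.Tendsto
      (fun n : ℕ =>
        Real.log (∑ w ∈ Lwords a b n, (∏ j : Fin n, qb q0 q1 (w j)) ^ (-s)) / n)
      Filter.atTop (nhds 0)) :
    piE (q0 ^ s) (q1 ^ s) a = piE (q0 ^ s) (q1 ^ s) b ∧
    ∀ t : ℝ, s < t → piE (q0 ^ t) (q1 ^ t) a ≠ piE (q0 ^ t) (q1 ^ t) b := by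
  simp only [S12.Z_eq hq0 hq1] at hlim
  have hpos := S12.wt_pos hq0 hq1
  have hZpos : ∀ n, 0 < S12.Z a b (S12.wt q0 q1 s) n := S12.Z_pos hW (hpos s)
  have hup := S12.log_upper hZpos hlim
  have hlo := S12.log_lower hZpos hlim
  constructor
  · obtain ⟨ρ, hρ1, hρ⟩ := S12.wt_bound hq0 hq1 s hs
    rw [S12.piE_eq hq0 hq1, S12.piE_eq hq0 hq1, S12.root (hpos s) hρ hρ1 hW hup hlo]
  · intro t ht h
    rw [S12.piE_eq hq0 hq1, S12.piE_eq hq0 hq1] at h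
    have h' := mul_left_cancel₀ (hpos t true).ne' h
    obtain ⟨ρ, hρ1, hρ⟩ := S12.wt_bound hq0 hq1 t (hs.trans ht)
    refine S12.no_root (hpos t) hρ hρ1 hW ?_ h'
    obtain ⟨σ, hσ1, hσ⟩ := S12.wt_bound hq0 hq1 (t - s) (sub_pos.2 ht)
    have hσ0 : 0 < σ := (hpos (t - s) true).trans_le (hσ true)
    obtain ⟨r, hr1, hr2⟩ := exists_between ((one_lt_inv₀ hσ0).2 hσ1)
    have hlt : σ * r < 1 := by
      have := mul_lt_mul_of_pos_left hr2 hσ0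
      rwa [mul_inv_cancel₀ hσ0.ne'] at this
    have ht0 : Tendsto (fun n : ℕ => (σ * r) ^ n) atTop (𝓝 0) :=
      tendsto_pow_atTop_nhds_zero_of_lt_one (by positivity) hlt
    refine tendsto_of_tendsto_of_tendsto_of_le_of_le' tendsto_const_nhds ht0
      (Eventually.of_forall fun n => (S12.Z_pos hW (hpos t) n).le) ?_
    filter_upwards [hup r hr1] with n hn
    calc S12.Z a b (S12.wt q0 q1 t) n ≤ σ ^ n * S12.Z a b (S12.wt q0 q1 s) n :=
          S12.Z_shift hq0 hq1 a b s t σ hσ n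
      _ ≤ σ ^ n * r ^ n := mul_le_mul_of_nonneg_left hn (by positivity)
      _ = (σ * r) ^ n := (mul_pow _ _ _).symm
end
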